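/- arXiv:2001.09017 — 14 statements merged into one kernel-verified Lean document; each statement's English description precedes it below -/
import Mathlib

section
/- Let P ⊆ ℝ^n be a polytope (the convex hull of a nonempty finite set of points) such that P ∩ {x : Ax = b} is nonempty. Then the primal linear program min{⟨c,x⟩ : x ∈ P, Ax = b} and its Lagrange dual max_{λ∈ℝ^m} min_{x∈P} (⟨c,x⟩ + ⟨λ, Ax − b⟩) both have optimal solutions (the minimum and the maximum are attained), and strong duality holds: min{⟨c,x⟩ : x ∈ P, Ax = b} = max_{λ∈ℝ^m} min_{x∈P} (⟨c,x⟩ + ⟨λ, Ax − b⟩). -/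
open Matrix

/-- **Farkas' lemma**, algebraic form: a linear functional which is nonpositive wherever finitely
many given functionals are nonpositive is a nonnegative combination of them. -/
theorem exists_nonneg_sum_smul_of_forall_nonpos {ι V : Type*} [AddCommGroup V] [Module ℝ V]
    (s : Finset ι) (a : ι → V →ₗ[ℝ] ℝ) (γ : V →ₗ[ℝ] ℝ)
    (h : ∀ x, (∀ i ∈ s, a i x ≤ 0) → γ x ≤ 0) :
    ∃ w : ι → ℝ, (∀ i ∈ s, 0 ≤ w i) ∧ γ = ∑ i ∈ s, w i • a i := by
  classical
  induction s using Finset.induction_on generalizing a γ with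
  | empty =>
    refine ⟨0, by simp, LinearMap.ext fun x => ?_⟩
    have h₁ := h x (by simp)
    have h₂ := h (-x) (by simp)
    rw [map_neg] at h₂
    simp only [Finset.sum_empty, LinearMap.zero_apply]
    linarith
  | insert j s hj ih =>
    by_cases hs : ∀ x, (∀ i ∈ s, a i x ≤ 0) → γ x ≤ 0
    · obtain ⟨w, hw, hγ⟩ := ih a γ hs
      refine ⟨Function.update w j 0, fun i hi => ?_, ?_⟩
      · rcases eq_or_ne i j with rfl | hij
        · simp
        · simpa [hij] using hw i (Finset.mem_of_mem_insert_of_ne hi hij)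
      · rw [Finset.sum_insert hj, hγ]
        simp only [Function.update_self, zero_smul, zero_add]
        refine Finset.sum_congr rfl fun i hi => ?_
        rw [Function.update_of_ne (ne_of_mem_of_not_mem hi hj)]
    · push Not at hs
      obtain ⟨y, hy, hγy⟩ := hs
      have hjy : 0 < a j y := by
        by_contra! hle
        exact hγy.not_ge (h y (by simpa [hle] using hy))
      obtain ⟨z, hz, hγz, hjz⟩ : ∃ z, (∀ i ∈ s, a i z ≤ 0) ∧ 0 < γ z ∧ a j z = 1 := by
        refine ⟨(a j y)⁻¹ • y, fun i hi => ?_, ?_, ?_⟩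
        · simpa using mul_nonpos_of_nonneg_of_nonpos (inv_nonneg.2 hjy.le) (hy i hi)
        · simpa using mul_pos (inv_pos.2 hjy) hγy
        · simp [hjy.ne']
      obtain ⟨w, hw, hγ⟩ := ih (fun i => a i - a i z • a j) (γ - γ z • a j) fun x hx => by
        have := h (x - a j x • z) fun i hi => by
          rcases Finset.mem_insert.1 hi with rfl | hi
          · simp [hjz]
          · simpa [mul_comm] using hx i hi
        simpa [mul_comm] using this
      refine ⟨Function.update w j (γ z - ∑ i ∈ s, w i * a i z), fun i hi => ?_, ?_⟩
      · rcases eq_or_ne i j with rfl | hij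
        · have : ∑ k ∈ s, w k * a k z ≤ 0 :=
            Finset.sum_nonpos fun k hk => mul_nonpos_of_nonneg_of_nonpos (hw k hk) (hz k hk)
          rw [Function.update_self]
          linarith
        · simpa [hij] using hw i (Finset.mem_of_mem_insert_of_ne hi hij)
      · have hsum : ∑ i ∈ s, Function.update w j (γ z - ∑ i ∈ s, w i * a i z) i • a i =
            ∑ i ∈ s, w i • a i := Finset.sum_congr rfl fun i hi => by
          rw [Function.update_of_ne (ne_of_mem_of_not_mem hi hj)]
        have hself (t : ℝ) : Function.update w j t j = t := Function.update_self j t w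
        rw [Finset.sum_insert hj, hsum, hself]
        rw [sub_eq_iff_eq_add] at hγ
        refine hγ.trans (LinearMap.ext fun x => ?_)
        simp only [LinearMap.add_apply, LinearMap.sub_apply, LinearMap.smul_apply,
          LinearMap.sum_apply, smul_eq_mul, mul_sub, sub_mul, Finset.sum_sub_distrib,
          Finset.sum_mul, mul_assoc]
        ring

/-- Given a lower bound `p` for a linear program over the convex hull of a finite set, there are
multipliers for which the Lagrangian is bounded below by `p` on the whole polytope. -/
theorem exists_forall_le_lagrangian {n m : ℕ} (S : Finset (Fin n → ℝ))
    (A : Matrix (Fin m) (Fin n) ℝ) (b : Fin m → ℝ) (c : Fin n → ℝ) (p : ℝ)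
    (hp : ∀ x ∈ convexHull ℝ (S : Set (Fin n → ℝ)), A *ᵥ x = b → p ≤ c ⬝ᵥ x) :
    ∃ lam : Fin m → ℝ, ∀ x ∈ convexHull ℝ (S : Set (Fin n → ℝ)),
      p ≤ c ⬝ᵥ x + lam ⬝ᵥ (A *ᵥ x - b) := by
  let a : (Fin n → ℝ) → ((Fin m → ℝ) × ℝ) →ₗ[ℝ] ℝ := fun s =>
    -((dotProductBilin ℝ ℝ (A *ᵥ s - b)).comp (LinearMap.fst ℝ _ _) +
      (c ⬝ᵥ s - p) • LinearMap.snd ℝ _ _)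
  have ha (s : Fin n → ℝ) (q : (Fin m → ℝ) × ℝ) :
      a s q = -((A *ᵥ s - b) ⬝ᵥ q.1 + (c ⬝ᵥ s - p) * q.2) := rfl
  obtain ⟨⟨lam, μ⟩, hq, hμ⟩ : ∃ q : (Fin m → ℝ) × ℝ, (∀ s ∈ S, a s q ≤ 0) ∧ 0 < q.2 := by
    by_contra! hcon
    obtain ⟨w, hw, hγ⟩ :=
      exists_nonneg_sum_smul_of_forall_nonpos S a (LinearMap.snd ℝ _ _) hcon
    have hcost : ∑ s ∈ S, w s * (c ⬝ᵥ s - p) = -1 := by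
      have := LinearMap.congr_fun hγ (0, 1)
      simp [ha, -neg_sub] at this
      linarith
    have hcons : ∑ s ∈ S, w s • (A *ᵥ s - b) = 0 := by
      ext i
      have := LinearMap.congr_fun hγ (Pi.single i 1, 0)
      simp [ha, -neg_sub] at this
      simpa using this
    have hW : 0 < ∑ s ∈ S, w s := by
      refine (Finset.sum_nonneg hw).lt_of_ne fun h0 => ?_
      have hz := (Finset.sum_eq_zero_iff_of_nonneg hw).1 h0.symm
      rw [Finset.sum_eq_zero fun s hs => by rw [hz s hs, zero_mul]] at hcost
      norm_num at hcost
    have hx := S.centerMass_mem_convexHull (z := id) hw hW fun s hs => hs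
    have hAx : A *ᵥ S.centerMass w id = b := by
      simp only [smul_sub, Finset.sum_sub_distrib, ← Finset.sum_smul, sub_eq_zero] at hcons
      simp only [Finset.centerMass, id, mulVec_smul, mulVec_sum, hcons, smul_smul]
      rw [inv_mul_cancel₀ hW.ne', one_smul]
    have hle := hp _ hx hAx
    simp only [Finset.centerMass, id, dotProduct_smul, dotProduct_sum, smul_eq_mul] at hle
    rw [← div_eq_inv_mul, le_div_iff₀ hW] at hle
    simp only [mul_sub, Finset.sum_sub_distrib, ← Finset.sum_mul] at hcost
    linarith
  refine ⟨μ⁻¹ • lam, fun x hx => ?_⟩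
  have hconv : Convex ℝ {x : Fin n → ℝ | p + (μ⁻¹ • lam) ⬝ᵥ b ≤ c ⬝ᵥ x + (μ⁻¹ • lam) ⬝ᵥ A *ᵥ x} :=
    convex_halfSpace_ge (f := fun x => c ⬝ᵥ x + (μ⁻¹ • lam) ⬝ᵥ A *ᵥ x)
      ⟨fun x y => by simp only [mulVec_add, dotProduct_add]; ring,
        fun t x => by simp only [mulVec_smul, dotProduct_smul, smul_eq_mul]; ring⟩ _
  have hmem := convexHull_min (fun s hs => ?_) hconv hx
  · rw [Set.mem_ofPred_eq] at hmem
    rw [dotProduct_sub]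
    linarith
  · have hs' := hq s hs
    rw [ha, dotProduct_comm] at hs'
    have := mul_nonneg (inv_nonneg.2 hμ.le) (neg_nonpos.1 hs')
    rw [mul_add, mul_left_comm, inv_mul_cancel₀ hμ.ne', dotProduct_sub] at this
    simp only [Set.mem_ofPred_eq, smul_dotProduct, smul_eq_mul]
    linarith

/-- **Strong Lagrange duality over a polytope.**
Let `P ⊆ ℝⁿ` be a polytope (the convex hull of a nonempty finite set) such that
`P ∩ {x : Ax = b}` is nonempty.  Then the primal problem
`min {⟨c,x⟩ : x ∈ P, Ax = b}` and the Lagrange dual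
`max_{λ} min_{x ∈ P} (⟨c,x⟩ + ⟨λ, Ax − b⟩)` both attain their optimal values,
and these optimal values coincide. -/
theorem statement_0 (n m : ℕ) (S : Finset (Fin n → ℝ)) (hS : S.Nonempty)
    (P : Set (Fin n → ℝ)) (hP : P = convexHull ℝ (S : Set (Fin n → ℝ)))
    (A : Matrix (Fin m) (Fin n) ℝ) (b : Fin m → ℝ) (c : Fin n → ℝ)
    (hfeas : ∃ x ∈ P, A.mulVec x = b) :
    ∃ p : ℝ,
      IsLeast {v : ℝ | ∃ x ∈ P, A.mulVec x = b ∧ v = c ⬝ᵥ x} p ∧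
      IsGreatest {v : ℝ | ∃ lam : Fin m → ℝ,
          v = sInf {w : ℝ | ∃ x ∈ P, w = c ⬝ᵥ x + lam ⬝ᵥ (A.mulVec x - b)}} p := by
  have hcpt : IsCompact P := hP ▸ S.finite_toSet.isCompact_convexHull ℝ
  obtain ⟨x₀, ⟨hx₀P, hx₀⟩, hmin⟩ := (hcpt.inter_right (t := {x | A *ᵥ x = b})
    (isClosed_eq (by fun_prop) continuous_const)).exists_isMinOn hfeas
    (f := fun x => c ⬝ᵥ x) (by fun_prop)
  rw [Set.mem_ofPred_eq] at hx₀
  have hle : ∀ x ∈ P, A *ᵥ x = b → c ⬝ᵥ x₀ ≤ c ⬝ᵥ x := fun x hx hAx => hmin ⟨hx, hAx⟩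
  refine ⟨c ⬝ᵥ x₀, ⟨⟨x₀, hx₀P, hx₀, rfl⟩, ?_⟩, ?_, ?_⟩
  · rintro _ ⟨x, hx, hAx, rfl⟩
    exact hle x hx hAx
  · subst hP
    obtain ⟨lam, hlam⟩ := exists_forall_le_lagrangian S A b c _ hle
    refine ⟨lam, Eq.symm (IsLeast.csInf_eq (And.intro ⟨x₀, hx₀P, by simp [hx₀]⟩ ?_))⟩
    rintro _ ⟨x, hx, rfl⟩
    exact hlam x hx
  · rintro _ ⟨lam, rfl⟩
    refine csInf_le ?_ ⟨x₀, hx₀P, by simp [hx₀]⟩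
    refine (hcpt.bddBelow_image (f := fun x => c ⬝ᵥ x + lam ⬝ᵥ (A *ᵥ x - b))
      (by fun_prop)).mono ?_
    rintro _ ⟨x, hx, rfl⟩
    exact ⟨x, hx, rfl⟩
end

section
/- Let P ⊆ ℝ^n be a polytope with P ∩ {0,1}^n nonempty, and suppose conv(P ∩ {0,1}^n) ∩ {x : Ax = b} is nonempty. Then the optimal value of the Lagrange dual of the 0/1 integer linear program min{⟨c,x⟩ : x ∈ P ∩ {0,1}^n, Ax = b} equals the optimal value of the linear program over the integer hull: max_{λ∈ℝ^m} min_{x ∈ P∩{0,1}^n} (⟨c,x⟩ + ⟨λ, Ax − b⟩) = min{⟨c,x⟩ : x ∈ conv(P ∩ {0,1}^n), Ax = b}, where the outer maximum over λ and the right-hand minimum are attained. -/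
open Matrix

/-- The **Farkas lemma** for finitely many linear functionals on a real vector space. -/
theorem exists_nonneg_combination_of_forall_nonpos {V ι : Type*} [AddCommGroup V] [Module ℝ V]
    (s : Finset ι) (a : ι → V →ₗ[ℝ] ℝ) (f : V →ₗ[ℝ] ℝ)
    (h : ∀ v, (∀ i ∈ s, a i v ≤ 0) → f v ≤ 0) :
    ∃ u : ι → ℝ, (∀ i ∈ s, 0 ≤ u i) ∧ ∀ v, f v = ∑ i ∈ s, u i * a i v := by
  classical
  induction s using Finset.induction_on generalizing a f with
  | empty =>
    refine ⟨0, by simp, fun v => ?_⟩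
    have h₁ := h v (by simp)
    have h₂ := h (-v) (by simp)
    rw [map_neg] at h₂
    simp only [Finset.sum_empty]
    linarith
  | insert k s hk ih =>
    by_cases hs : ∀ v, (∀ i ∈ s, a i v ≤ 0) → f v ≤ 0
    · obtain ⟨u, hu, hf⟩ := ih a f hs
      have hne : ∀ i ∈ s, i ≠ k := fun i hi e => hk (e ▸ hi)
      refine ⟨Function.update u k 0, fun i hi => ?_, fun v => ?_⟩
      · by_cases e : i = k
        · simp [e]
        · simpa [e] using hu i ((Finset.mem_insert.1 hi).resolve_left e)
      · rw [Finset.sum_insert hk, hf v, Function.update_self, zero_mul, zero_add]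
        exact Finset.sum_congr rfl fun i hi => by rw [Function.update_of_ne (hne i hi)]
    · push Not at hs
      obtain ⟨x, hx, hfx⟩ := hs
      have hkx : 0 < a k x := by
        by_contra! hle
        exact absurd (h x (by simpa [hle] using hx)) (not_le.2 hfx)
      obtain ⟨u, hu, hf⟩ := ih (fun i => a i - (a i x / a k x) • a k)
        (f - (f x / a k x) • a k) (fun v hv => by
          have hy := h (v - (a k v / a k x) • x) (by
            intro i hi
            rcases Finset.mem_insert.1 hi with rfl | hi
            · simp [hkx.ne']
            · have := hv i hi
              simp only [LinearMap.sub_apply, LinearMap.smul_apply, smul_eq_mul, map_sub,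
                map_smul] at this ⊢
              convert this using 1
              ring)
          simp only [LinearMap.sub_apply, LinearMap.smul_apply, smul_eq_mul, map_sub,
            map_smul] at hy ⊢
          convert hy using 1
          ring)
      have hne : ∀ i ∈ s, i ≠ k := fun i hi e => hk (e ▸ hi)
      refine ⟨Function.update u k ((f x - ∑ i ∈ s, u i * a i x) / a k x), fun i hi => ?_,
        fun v => ?_⟩
      · by_cases e : i = k
        · subst e
          rw [Function.update_self]
          have : ∑ j ∈ s, u j * a j x ≤ 0 :=
            Finset.sum_nonpos fun j hj => mul_nonpos_of_nonneg_of_nonpos (hu j hj) (hx j hj)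
          exact div_nonneg (by linarith) hkx.le
        · simpa [e] using hu i ((Finset.mem_insert.1 hi).resolve_left e)
      · have hupd : ∀ r : ℝ, ∑ i ∈ s, Function.update u k r i * a i v = ∑ i ∈ s, u i * a i v :=
          fun r => Finset.sum_congr rfl fun i hi => by rw [Function.update_of_ne (hne i hi)]
        rw [Finset.sum_insert hk, Function.update_self, hupd]
        have hv := hf v
        simp only [LinearMap.sub_apply, LinearMap.smul_apply, smul_eq_mul, mul_sub,
          Finset.sum_sub_distrib] at hv
        have e : ∑ i ∈ s, u i * (a i x / a k x * a k v)
            = (∑ i ∈ s, u i * a i x) / a k x * a k v := by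
          rw [Finset.sum_div, Finset.sum_mul]
          exact Finset.sum_congr rfl fun i _ => by ring
        rw [e] at hv
        rw [sub_div, sub_mul]
        linarith

/-- Strong duality: a lower bound `p` of a linear program over the convex hull of a finite set
is certified by a vector of Lagrange multipliers. -/
theorem exists_multiplier_of_forall_convexHull_le {n m : ℕ} {X : Set (Fin n → ℝ)} (hX : X.Finite)
    (A : Matrix (Fin m) (Fin n) ℝ) (b : Fin m → ℝ) (c : Fin n → ℝ) (p : ℝ)
    (hp : ∀ x ∈ convexHull ℝ X, A.mulVec x = b → p ≤ c ⬝ᵥ x) :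
    ∃ lam : Fin m → ℝ, ∀ x ∈ X, p ≤ c ⬝ᵥ x + lam ⬝ᵥ (A.mulVec x - b) := by
  classical
  let a : (Fin n → ℝ) → ((Fin m → ℝ) × ℝ) →ₗ[ℝ] ℝ := fun x =>
    -((dotProductBilin ℝ ℝ (A.mulVec x - b)).comp (LinearMap.fst ℝ _ _)
      + (c ⬝ᵥ x - p) • LinearMap.snd ℝ _ _)
  have ha : ∀ x v, a x v = -((A.mulVec x - b) ⬝ᵥ v.1 + (c ⬝ᵥ x - p) * v.2) := fun x v => rfl
  by_cases h : ∀ v, (∀ x ∈ hX.toFinset, a x v ≤ 0) → LinearMap.snd ℝ (Fin m → ℝ) ℝ v ≤ 0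
  · exfalso
    obtain ⟨u, hu, hf⟩ := exists_nonneg_combination_of_forall_nonpos hX.toFinset a _ h
    set s := hX.toFinset
    have hcost : ∑ x ∈ s, u x * (c ⬝ᵥ x - p) = -1 := by
      have := hf (0, 1)
      simp only [ha, LinearMap.snd_apply, dotProduct_zero, zero_add, mul_one, mul_neg,
        Finset.sum_neg_distrib] at this
      linarith
    have hcon : ∑ x ∈ s, u x • (A.mulVec x - b) = 0 := by
      refine dotProduct_eq_zero _ fun w => ?_
      have := hf (w, 0)
      simp only [ha, LinearMap.snd_apply, mul_zero, add_zero, mul_neg,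
        Finset.sum_neg_distrib] at this
      simp only [sum_dotProduct, smul_dotProduct, smul_eq_mul]
      linarith
    have hU : 0 < ∑ x ∈ s, u x := by
      refine (Finset.sum_nonneg hu).lt_of_ne fun e => ?_
      have hz := (Finset.sum_eq_zero_iff_of_nonneg hu).1 e.symm
      rw [Finset.sum_eq_zero fun x hx => by rw [hz x hx, zero_mul]] at hcost
      norm_num at hcost
    have hmem : s.centerMass u id ∈ convexHull ℝ X :=
      s.centerMass_mem_convexHull hu hU fun x hx => hX.mem_toFinset.1 hx
    have hA : A.mulVec (s.centerMass u id) = b := by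
      simp only [smul_sub, Finset.sum_sub_distrib, ← Finset.sum_smul, sub_eq_zero] at hcon
      simp only [Finset.centerMass, mulVec_smul, mulVec_sum, id]
      rw [hcon, smul_smul, inv_mul_cancel₀ hU.ne', one_smul]
    have hc := hp _ hmem hA
    simp only [mul_sub, Finset.sum_sub_distrib, ← Finset.sum_mul] at hcost
    simp only [Finset.centerMass, dotProduct_smul, dotProduct_sum, id, smul_eq_mul] at hc
    rw [le_inv_mul_iff₀ hU] at hc
    linarith
  · push Not at h
    obtain ⟨⟨w, t⟩, hv, ht⟩ := h
    replace ht : 0 < t := ht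
    refine ⟨t⁻¹ • w, fun x hx => ?_⟩
    have := hv x (hX.mem_toFinset.2 hx)
    rw [ha] at this
    rw [smul_dotProduct, smul_eq_mul, dotProduct_comm w, ← sub_nonneg]
    have e : c ⬝ᵥ x + t⁻¹ * ((A.mulVec x - b) ⬝ᵥ w) - p
        = t⁻¹ * ((A.mulVec x - b) ⬝ᵥ w + (c ⬝ᵥ x - p) * t) := by
      field_simp
      ring
    rw [e]
    exact mul_nonneg (inv_nonneg.2 ht.le) (by linarith)

/-- **Lagrange relaxation of a 0/1 ILP equals the LP over the integer hull.**
Let `P ⊆ ℝⁿ` be a polytope with `P ∩ {0,1}ⁿ` nonempty, and suppose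
`conv(P ∩ {0,1}ⁿ) ∩ {x : Ax = b}` is nonempty.  Then the optimal value of the
Lagrange dual of the ILP `min {⟨c,x⟩ : x ∈ P ∩ {0,1}ⁿ, Ax = b}` equals the
optimal value of the linear program over the integer hull, and both the outer
maximum over `λ` and the right-hand minimum are attained. -/
theorem statement_1 (n m : ℕ) (S : Finset (Fin n → ℝ)) (hS : S.Nonempty)
    (P : Set (Fin n → ℝ)) (hP : P = convexHull ℝ (S : Set (Fin n → ℝ)))
    (B : Set (Fin n → ℝ)) (hB : B = {x : Fin n → ℝ | ∀ i, x i = 0 ∨ x i = 1})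
    (hPB : (P ∩ B).Nonempty)
    (A : Matrix (Fin m) (Fin n) ℝ) (b : Fin m → ℝ) (c : Fin n → ℝ)
    (hfeas : ∃ x ∈ convexHull ℝ (P ∩ B), A.mulVec x = b) :
    ∃ p : ℝ,
      IsGreatest {v : ℝ | ∃ lam : Fin m → ℝ,
          v = sInf {w : ℝ | ∃ x ∈ P ∩ B, w = c ⬝ᵥ x + lam ⬝ᵥ (A.mulVec x - b)}} p ∧
      IsLeast {v : ℝ | ∃ x ∈ convexHull ℝ (P ∩ B), A.mulVec x = b ∧ v = c ⬝ᵥ x} p := by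
  have hBfin : B.Finite := by
    refine (Set.Finite.pi' fun _ : Fin n => Set.toFinite ({0, 1} : Set ℝ)).subset ?_
    rw [hB]
    exact fun x hx i => by simpa using hx i
  have hX : (P ∩ B).Finite := hBfin.subset Set.inter_subset_right
  generalize P ∩ B = X at *
  obtain ⟨y, ⟨hyX, hyb⟩, hy⟩ := ((hX.isCompact_convexHull ℝ).inter_right
    (isClosed_eq (f := fun x => A.mulVec x) (g := fun _ => b)
      (by fun_prop) continuous_const)).exists_isMinOn
    (f := fun x => c ⬝ᵥ x) (by obtain ⟨x, hx⟩ := hfeas; exact ⟨x, hx⟩) (by fun_prop)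
  have hmin : ∀ x ∈ convexHull ℝ X, A.mulVec x = b → c ⬝ᵥ y ≤ c ⬝ᵥ x :=
    fun x hx hxb => hy ⟨hx, hxb⟩
  have hweak : ∀ lam : Fin m → ℝ,
      sInf {w : ℝ | ∃ x ∈ X, w = c ⬝ᵥ x + lam ⬝ᵥ (A.mulVec x - b)} ≤ c ⬝ᵥ y := by
    intro lam
    set q := sInf {w : ℝ | ∃ x ∈ X, w = c ⬝ᵥ x + lam ⬝ᵥ (A.mulVec x - b)} with hq
    have hbdd : BddBelow {w : ℝ | ∃ x ∈ X, w = c ⬝ᵥ x + lam ⬝ᵥ (A.mulVec x - b)} := by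
      refine ((hX.image fun x => c ⬝ᵥ x + lam ⬝ᵥ (A.mulVec x - b)).subset ?_).bddBelow
      rintro w ⟨x, hx, rfl⟩
      exact ⟨x, hx, rfl⟩
    have hconv : Convex ℝ {x : Fin n → ℝ | q + lam ⬝ᵥ b ≤ (c + lam ᵥ* A) ⬝ᵥ x} :=
      convex_halfSpace_ge (dotProductBilin ℝ ℝ (c + lam ᵥ* A)).isLinear _
    have hsub := convexHull_min (s := X) (fun x hx => by
      have : q ≤ _ := csInf_le hbdd ⟨x, hx, rfl⟩
      rw [dotProduct_sub, dotProduct_mulVec] at this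
      rw [Set.mem_ofPred_eq]
      rw [add_dotProduct]
      linarith) hconv hyX
    rw [Set.mem_ofPred_eq, add_dotProduct, ← dotProduct_mulVec, hyb] at hsub
    linarith
  obtain ⟨lam, hlam⟩ := exists_multiplier_of_forall_convexHull_le hX A b c _ hmin
  refine ⟨c ⬝ᵥ y, ⟨⟨lam, le_antisymm (le_csInf ?_ ?_) (hweak lam)⟩, ?_⟩, ⟨y, hyX, hyb, rfl⟩, ?_⟩
  · obtain ⟨x, hx⟩ := hPB
    exact ⟨_, x, hx, rfl⟩
  · rintro w ⟨x, hx, rfl⟩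
    exact hlam x hx
  · rintro v ⟨l, rfl⟩
    exact hweak l
  · rintro v ⟨x, hx, hxb, rfl⟩
    exact hmin x hx hxb
end

section
/- Let P ⊆ ℝ^n be a polytope with P ∩ {0,1}^n nonempty, A ∈ ℝ^{m×n} and c ∈ ℝ^n. A vector λ* ∈ ℝ^m maximizes the dual function λ ↦ min_{x ∈ P∩{0,1}^n} ⟨c + Aᵀλ, x⟩ over ℝ^m if and only if there exists x* ∈ conv(P ∩ {0,1}^n) with Ax* = 0 and ⟨c + Aᵀλ*, x*⟩ = min_{x ∈ conv(P∩{0,1}^n)} ⟨c + Aᵀλ*, x⟩. Moreover, every such x* satisfies ⟨c, x*⟩ = min{⟨c,x⟩ : x ∈ conv(P ∩ {0,1}^n), Ax = 0}, i.e. it is a solution of the relaxed primal problem. -/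
open Matrix

/-- A lower bound for a linear functional on a set extends to the convex hull. -/
theorem le_dotProduct_of_mem_convexHull {n : ℕ} {K : Set (Fin n → ℝ)} {w : Fin n → ℝ} {a : ℝ}
    (h : ∀ x ∈ K, a ≤ w ⬝ᵥ x) : ∀ x ∈ convexHull ℝ K, a ≤ w ⬝ᵥ x := by
  have hc : Convex ℝ {x : Fin n → ℝ | a ≤ w ⬝ᵥ x} :=
    convex_halfSpace_ge ⟨fun x y => dotProduct_add w x y, fun r x => dotProduct_smul r w x⟩ a
  exact fun x hx => convexHull_min h hc hx

/-- If the convex hull of a finite set does not meet the kernel of a matrix `A`, then some linear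
functional `x ↦ ⟨lam, A x⟩` is positive on that set. -/
theorem exists_pos_dotProduct_mulVec {n m : ℕ} {K : Set (Fin n → ℝ)} (hK : K.Finite)
    (A : Matrix (Fin m) (Fin n) ℝ) (h : ∀ x ∈ convexHull ℝ K, A *ᵥ x ≠ 0) :
    ∃ lam : Fin m → ℝ, ∀ x ∈ K, 0 < lam ⬝ᵥ A *ᵥ x := by
  have himg := A.mulVecLin.image_convexHull K
  have h0 : (0 : Fin m → ℝ) ∉ convexHull ℝ (A.mulVecLin '' K) := by
    rw [← himg]
    rintro ⟨x, hx, hx0⟩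
    exact h x hx hx0
  obtain ⟨f, u, hfu, hf⟩ := geometric_hahn_banach_point_closed (convex_convexHull ℝ _)
    ((hK.image A.mulVecLin).isClosed_convexHull ℝ) h0
  rw [map_zero] at hfu
  refine ⟨fun i => f fun j => if i = j then 1 else 0, fun x hx => ?_⟩
  have hfx := hfu.trans (hf _ (subset_convexHull ℝ _ (Set.mem_image_of_mem A.mulVecLin hx)))
  have hrep : f (A *ᵥ x) = (fun i => f fun j => if i = j then 1 else 0) ⬝ᵥ A *ᵥ x := by
    rw [dotProduct_comm]
    exact f.toLinearMap.pi_apply_eq_sum_univ (A *ᵥ x)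
  rwa [mulVecLin_apply, hrep] at hfx

/-- On a finite set, perturbing the functional `w` in a direction `d` that is positive on the
minimizers of `w` strictly increases the minimum. -/
theorem exists_forall_lt_add_smul_dotProduct {n : ℕ} {K : Set (Fin n → ℝ)} (hK : K.Finite)
    {w d : Fin n → ℝ} {a : ℝ} (ha : ∀ x ∈ K, a ≤ w ⬝ᵥ x)
    (hd : ∀ x ∈ K, w ⬝ᵥ x = a → 0 < d ⬝ᵥ x) :
    ∃ ε : ℝ, ∀ x ∈ K, a < (w + ε • d) ⬝ᵥ x := by
  have key : ∀ᶠ ε : ℝ in nhdsWithin 0 (Set.Ioi 0), ∀ x ∈ K, a < (w + ε • d) ⬝ᵥ x := by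
    rw [Filter.eventually_all_finite hK]
    intro x hx
    simp only [add_dotProduct, smul_dotProduct, smul_eq_mul]
    rcases (ha x hx).eq_or_lt with h | h
    · filter_upwards [self_mem_nhdsWithin] with ε hε
      have := mul_pos (Set.mem_Ioi.mp hε) (hd x hx h.symm)
      linarith
    · have hcont : Continuous fun ε : ℝ => w ⬝ᵥ x + ε * d ⬝ᵥ x := by fun_prop
      exact (hcont.tendsto 0).eventually_const_lt (by simpa using h) |>.filter_mono
        nhdsWithin_le_nhds
  exact key.exists

/-- **Primal–dual optimality conditions for the Lagrange relaxation of a 0/1 ILP.**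
`λ*` maximizes the dual function `λ ↦ min_{x ∈ P∩{0,1}ⁿ} ⟨c + Aᵀλ, x⟩` if and only
if there exists `x* ∈ conv(P ∩ {0,1}ⁿ)` with `Ax* = 0` minimizing
`⟨c + Aᵀλ*, ·⟩` over `conv(P ∩ {0,1}ⁿ)`.  Moreover every such `x*` is a solution
of the relaxed primal problem `min {⟨c,x⟩ : x ∈ conv(P ∩ {0,1}ⁿ), Ax = 0}`. -/
theorem statement_2 (n m : ℕ) (S : Finset (Fin n → ℝ)) (hS : S.Nonempty)
    (P : Set (Fin n → ℝ)) (hP : P = convexHull ℝ (S : Set (Fin n → ℝ)))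
    (B : Set (Fin n → ℝ)) (hB : B = {x : Fin n → ℝ | ∀ i, x i = 0 ∨ x i = 1})
    (hPB : (P ∩ B).Nonempty)
    (A : Matrix (Fin m) (Fin n) ℝ) (c : Fin n → ℝ)
    (g : (Fin m → ℝ) → ℝ)
    (hg : ∀ lam, g lam = sInf {w : ℝ | ∃ x ∈ P ∩ B, w = (c + Matrix.vecMul lam A) ⬝ᵥ x})
    (lam0 : Fin m → ℝ) :
    ((∀ lam, g lam ≤ g lam0) ↔
      ∃ x0 ∈ convexHull ℝ (P ∩ B), A.mulVec x0 = 0 ∧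
        ∀ x ∈ convexHull ℝ (P ∩ B),
          (c + Matrix.vecMul lam0 A) ⬝ᵥ x0 ≤ (c + Matrix.vecMul lam0 A) ⬝ᵥ x) ∧
    (∀ x0 ∈ convexHull ℝ (P ∩ B), A.mulVec x0 = 0 →
      (∀ x ∈ convexHull ℝ (P ∩ B),
          (c + Matrix.vecMul lam0 A) ⬝ᵥ x0 ≤ (c + Matrix.vecMul lam0 A) ⬝ᵥ x) →
      IsLeast {v : ℝ | ∃ x ∈ convexHull ℝ (P ∩ B), A.mulVec x = 0 ∧ v = c ⬝ᵥ x} (c ⬝ᵥ x0)) := by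
  have hfin : (P ∩ B).Finite := by
    refine Set.Finite.inter_of_right ?_ P
    rw [hB]
    exact Set.Finite.pi' (t := fun _ : Fin n => {y : ℝ | y = 0 ∨ y = 1})
      fun _ => Set.toFinite ({0, 1} : Set ℝ)
  clear hP hB
  generalize P ∩ B = K at *
  have hleast : ∀ lam, (∃ x ∈ K, g lam = (c + Matrix.vecMul lam A) ⬝ᵥ x) ∧
      ∀ x ∈ K, g lam ≤ (c + Matrix.vecMul lam A) ⬝ᵥ x := by
    intro lam
    obtain ⟨x, hx, hmin⟩ := Set.exists_min_image K (fun x => (c + Matrix.vecMul lam A) ⬝ᵥ x)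
      hfin hPB
    have : IsLeast {w : ℝ | ∃ x ∈ K, w = (c + Matrix.vecMul lam A) ⬝ᵥ x}
        ((c + Matrix.vecMul lam A) ⬝ᵥ x) :=
      ⟨⟨x, hx, rfl⟩, by rintro _ ⟨y, hy, rfl⟩; exact hmin y hy⟩
    rw [hg, this.csInf_eq]
    exact ⟨⟨x, hx, rfl⟩, hmin⟩
  have hker : ∀ lam x, A.mulVec x = 0 → (c + Matrix.vecMul lam A) ⬝ᵥ x = c ⬝ᵥ x := by
    intro lam x hx
    rw [add_dotProduct, ← dotProduct_mulVec, hx, dotProduct_zero, add_zero]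
  refine ⟨⟨fun hmax => ?_, ?_⟩, ?_⟩
  · set M := {x ∈ K | (c + Matrix.vecMul lam0 A) ⬝ᵥ x = g lam0} with hM
    have hMK : M ⊆ K := Set.sep_subset _ _
    by_contra! hcon
    obtain ⟨d, hd⟩ := exists_pos_dotProduct_mulVec (hfin.subset hMK) A fun x hx hx0 => by
      obtain ⟨y, hy, hlt⟩ := hcon x (convexHull_mono hMK hx) hx0
      have h1 := le_dotProduct_of_mem_convexHull (hleast lam0).2 y hy
      have h2 := le_dotProduct_of_mem_convexHull (w := -(c + Matrix.vecMul lam0 A))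
        (a := -g lam0) (fun z hz => by rw [neg_dotProduct, hz.2]) x hx
      rw [neg_dotProduct] at h2
      linarith
    obtain ⟨ε, hε⟩ := exists_forall_lt_add_smul_dotProduct (d := Matrix.vecMul d A) hfin
      (hleast lam0).2 fun x hx hxe => by
        rw [← dotProduct_mulVec]
        exact hd x ⟨hx, hxe⟩
    obtain ⟨x, hx, hgx⟩ := (hleast (lam0 + ε • d)).1
    have hlt := hε x hx
    rw [add_assoc, ← smul_vecMul, ← add_vecMul, ← hgx] at hlt
    exact (hmax _).not_gt hlt
  · rintro ⟨x0, hx0, hA, hmin⟩ lam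
    obtain ⟨x, hx, hgx⟩ := (hleast lam0).1
    calc g lam ≤ (c + Matrix.vecMul lam A) ⬝ᵥ x0 :=
          le_dotProduct_of_mem_convexHull (hleast lam).2 x0 hx0
      _ = (c + Matrix.vecMul lam0 A) ⬝ᵥ x0 := by rw [hker _ _ hA, hker _ _ hA]
      _ ≤ g lam0 := hgx ▸ hmin x (subset_convexHull ℝ K hx)
  · intro x0 hx0 hA hmin
    refine ⟨⟨x0, hx0, hA, rfl⟩, ?_⟩
    rintro _ ⟨x, hx, hxA, rfl⟩
    simpa only [hker _ _ hA, hker _ _ hxA] using hmin x hx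
end

section
/- For any pairwise graphical model, the supremum of the Lagrange dual function D over all reparametrizations φ is attained and equals the optimal value of the local polytope relaxation: max_φ D(φ) = min_{μ ∈ L} ⟨θ, μ⟩; in particular, D(φ) ≤ ⟨θ, μ⟩ for every reparametrization φ and every μ ∈ L. -/
open Finset

/-- Minimum of a real-valued function on a nonempty finite type. -/
noncomputable def fmin {α : Type*} [Fintype α] [Nonempty α] (f : α → ℝ) : ℝ :=
  Finset.univ.inf' Finset.univ_nonempty f

variable {V : Type} [Fintype V] [DecidableEq V]

/-- Reparametrized unary cost `θ^φ_u(s) = θ_u(s) − Σ_{v : uv∈E} φ_{u,v}(s)`. -/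
noncomputable def repUnary (G : SimpleGraph V) [DecidableRel G.Adj]
    (Y : V → Type) (θv : ∀ u, Y u → ℝ) (φ : ∀ (u v : V), Y u → ℝ) (u : V) (s : Y u) : ℝ :=
  θv u s - ∑ v, if G.Adj u v then φ u v s else 0

/-- Reparametrized pairwise cost `θ^φ_{uv}(s,t) = θ_{uv}(s,t) + φ_{u,v}(s) + φ_{v,u}(t)`. -/
def repPair (Y : V → Type) (θe : ∀ u v, Y u → Y v → ℝ) (φ : ∀ (u v : V), Y u → ℝ)
    (u v : V) (s : Y u) (t : Y v) : ℝ :=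
  θe u v s t + φ u v s + φ v u t

/-- The Lagrange dual function
`D(φ) = Σ_u min_s θ^φ_u(s) + Σ_{uv∈E} min_{(s,t)} θ^φ_{uv}(s,t)`
(each unordered edge is counted once via the halved sum over ordered pairs). -/
noncomputable def dualD (G : SimpleGraph V) [DecidableRel G.Adj]
    (Y : V → Type) [∀ u, Fintype (Y u)] [∀ u, Nonempty (Y u)]
    (θv : ∀ u, Y u → ℝ) (θe : ∀ u v, Y u → Y v → ℝ)
    (φ : ∀ (u v : V), Y u → ℝ) : ℝ :=
  (∑ u, fmin (fun s : Y u => repUnary G Y θv φ u s)) +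
    (∑ u, ∑ v, if G.Adj u v then
        fmin (fun p : Y u × Y v => repPair Y θe φ u v p.1 p.2) else 0) / 2

/-- Membership in the local polytope `L`: `μ ≥ 0`, each unary block lies in the
probability simplex, both coupling (marginalization) constraints hold, the
pairwise blocks are symmetric (one variable per unordered edge) and vanish on
non-edges. -/
def memLocal (G : SimpleGraph V) [DecidableRel G.Adj]
    (Y : V → Type) [∀ u, Fintype (Y u)]
    (μv : ∀ u, Y u → ℝ) (μe : ∀ u v, Y u → Y v → ℝ) : Prop :=
  (∀ u s, 0 ≤ μv u s) ∧
  (∀ u v, G.Adj u v → ∀ s t, 0 ≤ μe u v s t) ∧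
  (∀ u v s t, μe u v s t = μe v u t s) ∧
  (∀ u v, ¬ G.Adj u v → ∀ s t, μe u v s t = 0) ∧
  (∀ u, ∑ s, μv u s = 1) ∧
  (∀ u v, G.Adj u v → ∀ t : Y v, ∑ s, μe u v s t = μv v t) ∧
  (∀ u v, G.Adj u v → ∀ s : Y u, ∑ t, μe u v s t = μv u s)

/-- The objective `⟨θ, μ⟩` of the local polytope relaxation
(each unordered edge counted once via the halved sum over ordered pairs). -/
noncomputable def ip (G : SimpleGraph V) [DecidableRel G.Adj]
    (Y : V → Type) [∀ u, Fintype (Y u)]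
    (θv : ∀ u, Y u → ℝ) (θe : ∀ u v, Y u → Y v → ℝ)
    (μv : ∀ u, Y u → ℝ) (μe : ∀ u v, Y u → Y v → ℝ) : ℝ :=
  (∑ u, ∑ s, θv u s * μv u s) +
    (∑ u, ∑ v, if G.Adj u v then ∑ s, ∑ t, θe u v s t * μe u v s t else 0) / 2

/-- **Farkas' lemma** for finitely many linear inequalities on a real vector space. -/
theorem exists_nonneg_combination_of_forall_nonneg {W ι : Type*} [AddCommGroup W] [Module ℝ W]
    (I : Finset ι) (f : ι → W →ₗ[ℝ] ℝ) (g : W →ₗ[ℝ] ℝ)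
    (h : ∀ x, (∀ i ∈ I, 0 ≤ f i x) → 0 ≤ g x) :
    ∃ c : ι → ℝ, (∀ i ∈ I, 0 ≤ c i) ∧ ∀ x, g x = ∑ i ∈ I, c i * f i x := by
  classical
  induction I using Finset.induction_on generalizing f g with
  | empty =>
    refine ⟨0, by simp, fun x => ?_⟩
    have h₁ := h x (by simp)
    have h₂ := h (-x) (by simp)
    rw [map_neg] at h₂
    simp only [Finset.sum_empty]
    linarith
  | insert a I ha ih =>
    by_cases hg : ∀ x, (∀ i ∈ I, 0 ≤ f i x) → 0 ≤ g x
    · obtain ⟨c, hc, hgc⟩ := ih f g hg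
      refine ⟨Function.update c a 0, fun i hi => ?_, fun x => ?_⟩
      · rcases eq_or_ne i a with rfl | hia
        · simp
        · simpa [hia] using hc i (Finset.mem_of_mem_insert_of_ne hi hia)
      · rw [hgc, Finset.sum_insert ha]
        simp only [Function.update_self, zero_mul, zero_add]
        refine Finset.sum_congr rfl fun i hi => ?_
        rw [Function.update_of_ne (ne_of_mem_of_not_mem hi ha)]
    · push Not at hg
      obtain ⟨y, hy, hgy⟩ := hg
      have hay : f a y < 0 := by
        by_contra! hay
        exact hgy.not_ge (h y fun i hi => by
          rcases Finset.mem_insert.1 hi with rfl | hi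
          exacts [hay, hy i hi])
      set k : ℝ := (-f a y)⁻¹ with hk
      have hk0 : 0 < k := inv_pos.2 (by linarith)
      have hka : k * f a y = -1 := by rw [hk, inv_neg, neg_mul, inv_mul_cancel₀ hay.ne]
      obtain ⟨c, hc, hgc⟩ := ih (fun i => f i + (k * f i y) • f a) (g + (k * g y) • f a) (by
        intro x hx
        have := h (x + (k * f a x) • y) (fun i hi => by
          rcases Finset.mem_insert.1 hi with rfl | hi
          · simp only [map_add, map_smul, smul_eq_mul]
            have : f i x + k * f i x * f i y = 0 := by linear_combination f i x * hka
            exact this.ge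
          · have := hx i hi
            simp only [LinearMap.add_apply, LinearMap.smul_apply, map_add, map_smul,
              smul_eq_mul] at this ⊢
            linarith)
        simp only [LinearMap.add_apply, LinearMap.smul_apply, map_add, map_smul,
          smul_eq_mul] at this ⊢
        linarith)
      refine ⟨Function.update c a (∑ i ∈ I, c i * (k * f i y) - k * g y), fun i hi => ?_,
        fun x => ?_⟩
      · rcases eq_or_ne i a with rfl | hia
        · have h₁ : 0 ≤ ∑ j ∈ I, c j * (k * f j y) := Finset.sum_nonneg fun j hj =>
            mul_nonneg (hc j hj) (mul_nonneg hk0.le (hy j hj))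
          have h₂ : k * g y < 0 := mul_neg_of_pos_of_neg hk0 hgy
          simp only [Function.update_self]
          linarith
        · simpa [hia] using hc i (Finset.mem_of_mem_insert_of_ne hi hia)
      · have h₁ := hgc x
        simp only [LinearMap.add_apply, LinearMap.smul_apply, smul_eq_mul] at h₁
        have h₂ : ∑ i ∈ I, Function.update c a (∑ i ∈ I, c i * (k * f i y) - k * g y) i * f i x
            = ∑ i ∈ I, c i * f i x := Finset.sum_congr rfl fun i hi => by
          rw [Function.update_of_ne (ne_of_mem_of_not_mem hi ha)]
        rw [Finset.sum_insert ha, h₂, Function.update_self, sub_mul, Finset.sum_mul]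
        simp only [mul_add, Finset.sum_add_distrib] at h₁
        have h₃ : ∑ i ∈ I, c i * (k * f i y * f a x) = ∑ i ∈ I, c i * (k * f i y) * f a x :=
          Finset.sum_congr rfl fun i _ => by ring
        linarith

/-- Farkas' lemma for a system of linear inequalities and linear equations. -/
theorem exists_combination_of_forall_nonneg_of_forall_eq_zero {W ι κ : Type*} [AddCommGroup W]
    [Module ℝ W] [Fintype ι] [Fintype κ] (f : ι → W →ₗ[ℝ] ℝ) (e : κ → W →ₗ[ℝ] ℝ)
    (g : W →ₗ[ℝ] ℝ) (h : ∀ x, (∀ i, 0 ≤ f i x) → (∀ k, e k x = 0) → 0 ≤ g x) :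
    ∃ (c : ι → ℝ) (d : κ → ℝ), (∀ i, 0 ≤ c i) ∧
      ∀ x, g x = ∑ i, c i * f i x + ∑ k, d k * e k x := by
  obtain ⟨c, hc, hg⟩ := exists_nonneg_combination_of_forall_nonneg Finset.univ
    (Sum.elim f (Sum.elim e fun k => -e k)) g (fun x hx => h x
      (fun i => hx (.inl i) (Finset.mem_univ _))
      (fun k => le_antisymm
        (by simpa using hx (.inr (.inr k)) (Finset.mem_univ _))
        (hx (.inr (.inl k)) (Finset.mem_univ _))))
  refine ⟨fun i => c (.inl i), fun k => c (.inr (.inl k)) - c (.inr (.inr k)),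
    fun i => hc _ (Finset.mem_univ _), fun x => ?_⟩
  rw [hg]
  simp only [Fintype.sum_sum_type, Sum.elim_inl, Sum.elim_inr, LinearMap.neg_apply, sub_mul,
    Finset.sum_sub_distrib, mul_neg, Finset.sum_neg_distrib]
  ring

theorem fmin_le {α : Type*} [Fintype α] [Nonempty α] (f : α → ℝ) (a : α) : fmin f ≤ f a :=
  Finset.inf'_le _ (Finset.mem_univ a)

theorem exists_eq_fmin {α : Type*} [Fintype α] [Nonempty α] (f : α → ℝ) : ∃ a, f a = fmin f := by
  obtain ⟨a, -, ha⟩ := Finset.exists_mem_eq_inf' Finset.univ_nonempty f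
  exact ⟨a, ha.symm⟩

section LocalPolytope

variable (G : SimpleGraph V) [DecidableRel G.Adj] (Y : V → Type) [∀ u, Fintype (Y u)]

theorem ip_add (θv : ∀ u, Y u → ℝ) (θe : ∀ u v, Y u → Y v → ℝ)
    (μv νv : ∀ u, Y u → ℝ) (μe νe : ∀ u v, Y u → Y v → ℝ) :
    ip G Y θv θe (μv + νv) (μe + νe) = ip G Y θv θe μv μe + ip G Y θv θe νv νe := by
  have h : ∀ u v, (if G.Adj u v then ∑ s, ∑ t, θe u v s t * (μe + νe) u v s t else 0) =
      (if G.Adj u v then ∑ s, ∑ t, θe u v s t * μe u v s t else 0) +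
        if G.Adj u v then ∑ s, ∑ t, θe u v s t * νe u v s t else 0 := fun u v => by
    split_ifs <;> simp [mul_add, Finset.sum_add_distrib]
  simp only [ip, h]
  simp only [Pi.add_apply, mul_add, Finset.sum_add_distrib]
  ring

theorem ip_smul (θv : ∀ u, Y u → ℝ) (θe : ∀ u v, Y u → Y v → ℝ) (c : ℝ)
    (μv : ∀ u, Y u → ℝ) (μe : ∀ u v, Y u → Y v → ℝ) :
    ip G Y θv θe (c • μv) (c • μe) = c * ip G Y θv θe μv μe := by
  have h : ∀ u v, (if G.Adj u v then ∑ s, ∑ t, θe u v s t * (c • μe) u v s t else 0) =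
      c * if G.Adj u v then ∑ s, ∑ t, θe u v s t * μe u v s t else 0 := fun u v => by
    split_ifs <;> simp [mul_left_comm _ c, Finset.mul_sum]
  simp only [ip, h]
  simp only [Pi.smul_apply, smul_eq_mul, mul_left_comm _ c, ← Finset.mul_sum]
  ring

/-- Exchanging the two endpoints in a sum over all labelled ordered edges. -/
theorem sum_adj_swap (F : ∀ u v, Y u → Y v → ℝ) :
    (∑ u, ∑ v, if G.Adj u v then ∑ s, ∑ t, F u v s t else 0) =
      ∑ u, ∑ v, if G.Adj u v then ∑ s, ∑ t, F v u t s else 0 := by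
  rw [Finset.sum_comm]
  refine Finset.sum_congr rfl fun u _ => Finset.sum_congr rfl fun v _ => ?_
  rw [Finset.sum_comm]
  simp only [G.adj_comm v u]

/-- The pairwise part of `μ`, symmetrized and restricted to the edges. -/
noncomputable def symmPair (μe : ∀ u v, Y u → Y v → ℝ) : ∀ u v, Y u → Y v → ℝ :=
  fun u v s t => if G.Adj u v then (μe u v s t + μe v u t s) / 2 else 0

theorem ip_symmPair (θv : ∀ u, Y u → ℝ) (θe : ∀ u v, Y u → Y v → ℝ)
    (hθsym : ∀ u v s t, θe u v s t = θe v u t s)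
    (μv : ∀ u, Y u → ℝ) (μe : ∀ u v, Y u → Y v → ℝ) :
    ip G Y θv θe μv (symmPair G Y μe) = ip G Y θv θe μv μe := by
  have h : ∀ u v,
      (if G.Adj u v then ∑ s, ∑ t, θe u v s t * symmPair G Y μe u v s t else 0) =
        (if G.Adj u v then ∑ s, ∑ t, θe u v s t * μe u v s t else 0) / 2 +
          (if G.Adj u v then ∑ s, ∑ t, θe v u t s * μe v u t s else 0) / 2 := fun u v => by
    split_ifs with huv
    · simp only [symmPair, if_pos huv, Finset.sum_div, ← Finset.sum_add_distrib]
      refine Finset.sum_congr rfl fun s _ => Finset.sum_congr rfl fun t _ => ?_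
      rw [hθsym v u t s]
      ring
    · simp
  simp only [ip, h, Finset.sum_add_distrib, ← Finset.sum_div]
  rw [← sum_adj_swap G Y fun u v s t => θe u v s t * μe u v s t]
  ring

/-- Violation of the coupling constraint at `u`, `v`, `s` by the symmetrized pairwise part. -/
noncomputable def couplingGap (μv : ∀ u, Y u → ℝ) (μe : ∀ u v, Y u → Y v → ℝ)
    (u v : V) (s : Y u) : ℝ :=
  if G.Adj u v then ∑ t, symmPair G Y μe u v s t - μv u s else 0

/-- The Lagrangian of the local polytope relaxation. -/
theorem ip_repUnary_repPair (θv : ∀ u, Y u → ℝ) (θe : ∀ u v, Y u → Y v → ℝ)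
    (φ : ∀ (u v : V), Y u → ℝ) (μv : ∀ u, Y u → ℝ) (μe : ∀ u v, Y u → Y v → ℝ) :
    ip G Y (repUnary G Y θv φ) (repPair Y θe φ) μv μe =
      ip G Y θv θe μv μe + ∑ u, ∑ v, ∑ s, φ u v s * couplingGap G Y μv μe u v s := by
  have h₁ : ∀ u v, ∑ s, φ u v s * couplingGap G Y μv μe u v s =
      (if G.Adj u v then ∑ s, ∑ t, φ u v s * μe u v s t else 0) / 2 +
      (if G.Adj u v then ∑ s, ∑ t, φ u v s * μe v u t s else 0) / 2 -
      ∑ s, (if G.Adj u v then φ u v s else 0) * μv u s := fun u v => by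
    by_cases huv : G.Adj u v
    · simp only [couplingGap, symmPair, if_pos huv, Finset.sum_div, ← Finset.sum_add_distrib,
        ← Finset.sum_sub_distrib]
      refine Finset.sum_congr rfl fun s _ => ?_
      rw [mul_sub, Finset.mul_sum]
      congr 1
      exact Finset.sum_congr rfl fun t _ => by ring
    · simp [couplingGap, huv]
  have h₂ : ∀ u v, (if G.Adj u v then ∑ s, ∑ t, repPair Y θe φ u v s t * μe u v s t else 0) =
      (if G.Adj u v then ∑ s, ∑ t, θe u v s t * μe u v s t else 0) +
      (if G.Adj u v then ∑ s, ∑ t, φ u v s * μe u v s t else 0) +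
      (if G.Adj u v then ∑ s, ∑ t, φ v u t * μe u v s t else 0) := fun u v => by
    split_ifs
    · simp only [repPair, add_mul, Finset.sum_add_distrib]
    · simp
  have h₃ : ∀ u, ∑ s, repUnary G Y θv φ u s * μv u s =
      ∑ s, θv u s * μv u s - ∑ v, ∑ s, (if G.Adj u v then φ u v s else 0) * μv u s := fun u => by
    rw [Finset.sum_comm, ← Finset.sum_sub_distrib]
    exact Finset.sum_congr rfl fun s _ => by rw [repUnary, sub_mul, Finset.sum_mul]
  simp only [ip, h₁, h₂, h₃, Finset.sum_add_distrib, Finset.sum_sub_distrib, ← Finset.sum_div]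
  rw [sum_adj_swap G Y fun u v s t => φ u v s * μe v u t s]
  ring

variable {G Y} in
theorem couplingGap_eq_zero {μv : ∀ u, Y u → ℝ} {μe : ∀ u v, Y u → Y v → ℝ}
    (h : memLocal G Y μv μe) (u v : V) (s : Y u) : couplingGap G Y μv μe u v s = 0 := by
  obtain ⟨-, -, hsym, -, -, -, hr⟩ := h
  unfold couplingGap
  split_ifs with huv
  · rw [← hr u v huv s, sub_eq_zero]
    refine Finset.sum_congr rfl fun t _ => ?_
    rw [symmPair, if_pos huv, hsym v u t s]
    ring
  · rfl

/-- The set of feasible points of the local polytope relaxation is compact. -/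
theorem isCompact_setOf_memLocal :
    IsCompact {x : (∀ u, Y u → ℝ) × (∀ u v, Y u → Y v → ℝ) | memLocal G Y x.1 x.2} := by
  refine (isCompact_Icc (a := (0 : (∀ u, Y u → ℝ) × (∀ u v, Y u → Y v → ℝ)))
    (b := 1)).of_isClosed_subset ?_ ?_
  · simp only [memLocal, Set.ofPred_and, Set.ofPred_forall]
    refine .inter ?_ <| .inter ?_ <| .inter ?_ <| .inter ?_ <| .inter ?_ <| .inter ?_ ?_
    all_goals repeat' refine isClosed_iInter fun _ => ?_
    all_goals first
      | exact isClosed_le (by fun_prop) (by fun_prop)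
      | exact isClosed_eq (by fun_prop) (by fun_prop)
  · rintro ⟨μv, μe⟩ ⟨h₁, h₂, -, h₄, h₅, -, h₇⟩
    dsimp only at h₁ h₂ h₄ h₅ h₇
    have hv : ∀ u s, μv u s ≤ 1 := fun u s => by
      rw [← h₅ u]
      exact Finset.single_le_sum (fun s _ => h₁ u s) (Finset.mem_univ s)
    refine ⟨⟨h₁, fun u v s t => ?_⟩, ⟨hv, fun u v s t => ?_⟩⟩ <;> by_cases huv : G.Adj u v
    · exact h₂ u v huv s t
    · exact (h₄ u v huv s t).ge
    · refine le_trans (b := μv u s) ?_ (hv u s)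
      rw [← h₇ u v huv s]
      exact Finset.single_le_sum (fun t _ => h₂ u v huv s t) (Finset.mem_univ t)
    · exact (h₄ u v huv s t).trans_le zero_le_one

theorem continuous_ip (θv : ∀ u, Y u → ℝ) (θe : ∀ u v, Y u → Y v → ℝ) :
    Continuous fun x : (∀ u, Y u → ℝ) × (∀ u v, Y u → Y v → ℝ) => ip G Y θv θe x.1 x.2 := by
  unfold ip
  refine .add (by fun_prop) (.div_const (continuous_finsetSum _ fun u _ =>
    continuous_finsetSum _ fun v _ => ?_) _)
  split_ifs <;> fun_prop

variable [∀ u, Nonempty (Y u)]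

/-- The uniform distributions form a point of the local polytope. -/
theorem exists_memLocal : ∃ μv μe, memLocal G Y μv μe := by
  refine ⟨fun u _ => (Fintype.card (Y u) : ℝ)⁻¹, fun u v _ _ => if G.Adj u v then
    (Fintype.card (Y u) : ℝ)⁻¹ * (Fintype.card (Y v) : ℝ)⁻¹ else 0, fun u s => by positivity,
    fun u v huv s t => ?_, fun u v s t => ?_, fun u v huv s t => if_neg huv, fun u => ?_,
    fun u v huv t => ?_, fun u v huv s => ?_⟩
  · simp only [if_pos huv]
    positivity
  · simp only [G.adj_comm v u, mul_comm]
  · simp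
  · simp [huv]
  · simp [huv, mul_left_comm]

/-- **Weak duality**. -/
theorem dualD_le_ip (θv : ∀ u, Y u → ℝ) (θe : ∀ u v, Y u → Y v → ℝ)
    (φ : ∀ (u v : V), Y u → ℝ) (μv : ∀ u, Y u → ℝ) (μe : ∀ u v, Y u → Y v → ℝ)
    (h : memLocal G Y μv μe) : dualD G Y θv θe φ ≤ ip G Y θv θe μv μe := by
  have hL := ip_repUnary_repPair G Y θv θe φ μv μe
  simp only [couplingGap_eq_zero h, mul_zero, Finset.sum_const_zero, add_zero] at hL
  rw [← hL]
  obtain ⟨h₁, h₂, -, -, h₅, -, h₇⟩ := h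
  unfold dualD ip
  gcongr with u _ u _ v _
  · calc _ = ∑ s, fmin (fun s => repUnary G Y θv φ u s) * μv u s := by
          rw [← Finset.mul_sum, h₅, mul_one]
      _ ≤ _ := Finset.sum_le_sum fun s _ =>
          mul_le_mul_of_nonneg_right (fmin_le (fun s => repUnary G Y θv φ u s) s) (h₁ u s)
  · split_ifs with huv
    · calc _ = ∑ s, ∑ t,
            fmin (fun p : Y u × Y v => repPair Y θe φ u v p.1 p.2) * μe u v s t := by
            simp only [← Finset.mul_sum, h₇ u v huv, h₅, mul_one]
        _ ≤ _ := Finset.sum_le_sum fun s _ => Finset.sum_le_sum fun t _ =>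
            mul_le_mul_of_nonneg_right
              (fmin_le (fun p : Y u × Y v => repPair Y θe φ u v p.1 p.2) (s, t))
              (h₂ u v huv s t)
    · exact le_rfl

/-- The dual function is the Lagrangian evaluated at indicators of minimizing labels. -/
theorem exists_ip_repUnary_repPair_eq_dualD (θv : ∀ u, Y u → ℝ)
    (θe : ∀ u v, Y u → Y v → ℝ) (φ : ∀ (u v : V), Y u → ℝ) :
    ∃ (μv : ∀ u, Y u → ℝ) (μe : ∀ u v, Y u → Y v → ℝ), (∀ u s, 0 ≤ μv u s) ∧
      (∀ u v s t, 0 ≤ μe u v s t) ∧ (∀ u, ∑ s, μv u s = 1) ∧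
      ip G Y (repUnary G Y θv φ) (repPair Y θe φ) μv μe = dualD G Y θv θe φ := by
  classical
  choose a ha using fun u => exists_eq_fmin fun s : Y u => repUnary G Y θv φ u s
  choose b hb using fun u v =>
    exists_eq_fmin fun p : Y u × Y v => repPair Y θe φ u v p.1 p.2
  refine ⟨fun u s => if s = a u then 1 else 0,
    fun u v s t => if t = (b u v).2 then if s = (b u v).1 then 1 else 0 else 0,
    fun u s => by positivity, fun u v s t => by positivity, fun u => by simp, ?_⟩
  simp [ip, dualD, ← ha, ← hb]

/-- **Strong duality**: a lower bound of the relaxation is attained by the dual function. -/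
theorem exists_le_dualD (θv : ∀ u, Y u → ℝ) (θe : ∀ u v, Y u → Y v → ℝ)
    (hθsym : ∀ u v s t, θe u v s t = θe v u t s) (p : ℝ)
    (hp : ∀ μv μe, memLocal G Y μv μe → p ≤ ip G Y θv θe μv μe) :
    ∃ φ, p ≤ dualD G Y θv θe φ := by
  let f : ((Σ u, Y u) ⊕ (Σ u v, Y u × Y v)) ⊕ Unit →
      (((∀ u, Y u → ℝ) × (∀ u v, Y u → Y v → ℝ)) × ℝ) →ₗ[ℝ] ℝ := fun i =>
    IsLinearMap.mk' (fun x => Sum.elim (Sum.elim (fun j => x.1.1 j.1 j.2)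
      (fun j => x.1.2 j.1 j.2.1 j.2.2.1 j.2.2.2)) (fun _ => x.2) i)
      (by constructor <;> intros <;> rcases i with (i | i) | i <;> simp)
  let e : V ⊕ (Σ (u : V) (_ : V), Y u) →
      (((∀ u, Y u → ℝ) × (∀ u v, Y u → Y v → ℝ)) × ℝ) →ₗ[ℝ] ℝ := fun k =>
    IsLinearMap.mk' (fun x => Sum.elim (fun u => ∑ s, x.1.1 u s - x.2)
      (fun j => couplingGap G Y x.1.1 x.1.2 j.1 j.2.1 j.2.2) k) (by
        constructor
        · rintro x y
          rcases k with u | ⟨u, v, s⟩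
          · simp only [Sum.elim_inl, Prod.fst_add, Prod.snd_add, Pi.add_apply,
              Finset.sum_add_distrib]
            ring
          · by_cases huv : G.Adj u v
            · simp only [Sum.elim_inr, couplingGap, symmPair, huv, if_true, Prod.fst_add,
                Prod.snd_add, Pi.add_apply, Finset.sum_add_distrib, ← Finset.sum_div]
              ring
            · simp [couplingGap, huv]
        · rintro c x
          rcases k with u | ⟨u, v, s⟩
          · simp only [Sum.elim_inl, Prod.smul_fst, Prod.smul_snd, Pi.smul_apply, smul_eq_mul,
              ← Finset.mul_sum]
            ring
          · by_cases huv : G.Adj u v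
            · simp only [Sum.elim_inr, couplingGap, symmPair, huv, if_true, Prod.smul_fst,
                Prod.smul_snd, Pi.smul_apply, smul_eq_mul, Finset.sum_add_distrib,
                ← Finset.sum_div, ← Finset.mul_sum]
              ring
            · simp [couplingGap, huv])
  let g : (((∀ u, Y u → ℝ) × (∀ u v, Y u → Y v → ℝ)) × ℝ) →ₗ[ℝ] ℝ :=
    IsLinearMap.mk' (fun x => ip G Y θv θe x.1.1 x.1.2 - p * x.2) (by
    constructor
    · intro x y
      simp only [Prod.fst_add, Prod.snd_add, ip_add]
      ring
    · intro c x
      simp only [Prod.smul_fst, Prod.smul_snd, ip_smul, smul_eq_mul]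
      ring)
  obtain ⟨c, d, hc, hg⟩ := exists_combination_of_forall_nonneg_of_forall_eq_zero f e g (by
    rintro ⟨⟨μv, μe⟩, τ⟩ hf he
    have h₁ : ∀ u s, 0 ≤ μv u s := fun u s => hf (.inl (.inl ⟨u, s⟩))
    have h₂ : ∀ u v s t, 0 ≤ μe u v s t := fun u v s t => hf (.inl (.inr ⟨u, v, s, t⟩))
    have hτ : 0 ≤ τ := hf (.inr ())
    have h₅ : ∀ u, ∑ s, μv u s = τ := fun u => sub_eq_zero.1 (he (.inl u))
    have h₇ : ∀ u v, G.Adj u v → ∀ s, ∑ t, symmPair G Y μe u v s t = μv u s :=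
      fun u v huv s => by
        have : couplingGap G Y μv μe u v s = 0 := he (.inr ⟨u, v, s⟩)
        rwa [couplingGap, if_pos huv, sub_eq_zero] at this
    have hs : ∀ u v s t, 0 ≤ symmPair G Y μe u v s t := fun u v s t => by
      have := h₂ u v s t
      have := h₂ v u t s
      unfold symmPair
      split_ifs <;> positivity
    have hsymm : ∀ u v s t, symmPair G Y μe u v s t = symmPair G Y μe v u t s :=
      fun u v s t => by simp only [symmPair, G.adj_comm v u, add_comm]
    change 0 ≤ ip G Y θv θe μv μe - p * τ
    rw [← ip_symmPair G Y θv θe hθsym]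
    rcases hτ.eq_or_lt with rfl | hτ
    · have hv : ∀ u s, μv u s = 0 := fun u s =>
        (Finset.sum_eq_zero_iff_of_nonneg fun s _ => h₁ u s).1 (h₅ u) s (Finset.mem_univ s)
      have he : ∀ u v, G.Adj u v → ∀ s t, symmPair G Y μe u v s t = 0 := fun u v huv s t =>
        (Finset.sum_eq_zero_iff_of_nonneg fun t _ => hs u v s t).1
          ((h₇ u v huv s).trans (hv u s)) t (Finset.mem_univ t)
      have : ip G Y θv θe μv (symmPair G Y μe) = 0 := by
        simp +contextual [ip, hv, he]
      simp [this]
    · have := hp (τ⁻¹ • μv) (τ⁻¹ • symmPair G Y μe) ⟨fun u s => ?_, fun u v _ s t => ?_,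
        fun u v s t => ?_, fun u v huv s t => ?_, fun u => ?_, fun u v huv t => ?_,
        fun u v huv s => ?_⟩
      · rw [ip_smul, inv_mul_eq_div, le_div_iff₀ hτ] at this
        linarith
      · exact mul_nonneg (inv_nonneg.2 hτ.le) (h₁ u s)
      · exact mul_nonneg (inv_nonneg.2 hτ.le) (hs u v s t)
      · simp only [Pi.smul_apply, hsymm u v s t]
      · simp [symmPair, huv]
      · simp only [Pi.smul_apply, smul_eq_mul, ← Finset.mul_sum, h₅]
        exact inv_mul_cancel₀ hτ.ne'
      · simp only [Pi.smul_apply, smul_eq_mul, ← Finset.mul_sum, hsymm u v, h₇ v u huv.symm]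
      · simp only [Pi.smul_apply, smul_eq_mul, ← Finset.mul_sum, h₇ u v huv])
  let φ : ∀ (u v : V), Y u → ℝ := fun u v s => -d (.inr ⟨u, v, s⟩)
  obtain ⟨μv, μe, h₁, h₂, h₅, hD⟩ := exists_ip_repUnary_repPair_eq_dualD G Y θv θe φ
  refine ⟨φ, ?_⟩
  have hgx : ip G Y θv θe μv μe - p * 1 = _ := hg ((μv, μe), 1)
  have hnonneg : 0 ≤ ∑ i, c i * f i ((μv, μe), 1) := Finset.sum_nonneg fun i _ =>
    mul_nonneg (hc i) (by
      rcases i with (⟨u, s⟩ | ⟨u, v, s, t⟩) | _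
      exacts [h₁ u s, h₂ u v s t, zero_le_one])
  have heq : ∑ k, d k * e k ((μv, μe), 1) =
      -∑ u, ∑ v, ∑ s, φ u v s * couplingGap G Y μv μe u v s := by
    simp [Fintype.sum_sum_type, Fintype.sum_sigma, e, φ, h₅]
  rw [heq] at hgx
  rw [← hD, ip_repUnary_repPair]
  linarith

end LocalPolytope

/-- **The Lagrange dual attains its maximum, which equals the optimal value of
the local polytope relaxation**: `max_φ D(φ) = min_{μ ∈ L} ⟨θ, μ⟩`; in
particular `D(φ) ≤ ⟨θ, μ⟩` for every reparametrization `φ` and every `μ ∈ L`. -/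
theorem statement_3 (G : SimpleGraph V) [DecidableRel G.Adj]
    (Y : V → Type) [∀ u, Fintype (Y u)] [∀ u, Nonempty (Y u)]
    (θv : ∀ u, Y u → ℝ) (θe : ∀ u v, Y u → Y v → ℝ)
    (hθsym : ∀ u v s t, θe u v s t = θe v u t s) :
    (∃ p : ℝ,
      IsGreatest (Set.range (dualD G Y θv θe)) p ∧
      IsLeast {r : ℝ | ∃ μv μe, memLocal G Y μv μe ∧ r = ip G Y θv θe μv μe} p) ∧
    ∀ (φ : ∀ (u v : V), Y u → ℝ) (μv : ∀ u, Y u → ℝ) (μe : ∀ u v, Y u → Y v → ℝ),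
      memLocal G Y μv μe → dualD G Y θv θe φ ≤ ip G Y θv θe μv μe := by
  obtain ⟨νv, νe, hν⟩ := exists_memLocal G Y
  obtain ⟨⟨μv, μe⟩, hμ, hmin⟩ := (isCompact_setOf_memLocal G Y).exists_isMinOn
    ⟨(νv, νe), hν⟩ (continuous_ip G Y θv θe).continuousOn
  obtain ⟨φ, hφ⟩ := exists_le_dualD G Y θv θe hθsym (ip G Y θv θe μv μe)
    fun ξv ξe hξ => hmin (a := (ξv, ξe)) hξ
  have hweak := dualD_le_ip G Y θv θe
  refine ⟨⟨ip G Y θv θe μv μe, ⟨⟨φ, (hweak φ μv μe hμ).antisymm hφ⟩, ?_⟩,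
    ⟨μv, μe, hμ, rfl⟩, ?_⟩, hweak⟩
  · rintro _ ⟨ψ, rfl⟩
    exact hweak ψ μv μe hμ
  · rintro _ ⟨ξv, ξe, hξ, rfl⟩
    exact hmin (a := (ξv, ξe)) hξ
end

section
/- Let the graph G of a pairwise graphical model be connected and acyclic (a tree), and let ξ be an arc-consistent 0/1 vector that is not identically zero. Then for every node w ∈ V and label s ∈ Y_w with ξ_w(s) = 1 there exists a labeling y with y_w = s such that ξ_u(y_u) = 1 for every node u ∈ V and ξ_{uv}(y_u, y_v) = 1 for every edge uv ∈ E; similarly, for every edge uv ∈ E and label pair (s,t) with ξ_{uv}(s,t) = 1 there exists such a labeling with y_u = s and y_v = t. -/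
variable {V : Type} [Fintype V] [DecidableEq V]

/-- Propagate a label from the end of a walk back to its start along transition maps `f`. -/
def SimpleGraph.Walk.pullLabel {W : Type*} {G : SimpleGraph W} {S : W → Type*}
    (f : ∀ u v, G.Adj u v → S u → S v) : ∀ {u w : W}, G.Walk u w → S w → S u
  | _, _, .nil, s => s
  | _, _, .cons h p, s => f _ _ h.symm (p.pullLabel f s)

/-- Paths in an acyclic graph from adjacent nodes to a common end extend one another. -/
theorem SimpleGraph.IsAcyclic.eq_cons_or_eq_cons {W : Type*} {G : SimpleGraph W}
    (hG : G.IsAcyclic) {u v w : W} (h : G.Adj u v) {p : G.Walk u w} {q : G.Walk v w}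
    (hp : p.IsPath) (hq : q.IsPath) : p = .cons h q ∨ q = .cons h.symm p := by
  classical
  by_cases hu : u ∈ q.support
  · right
    have hv : v ∉ p.support := fun hv =>
      hG.ne_mem_support_of_support_of_adj_of_isPath hp.reverse hq.reverse h
        (by simpa using hv) (by simpa using hu)
    exact congrArg Subtype.val ((hG.subsingleton_path v w).elim ⟨q, hq⟩ ⟨_, hp.cons hv⟩)
  · left
    exact congrArg Subtype.val ((hG.subsingleton_path u w).elim ⟨p, hp⟩ ⟨_, hq.cons hu⟩)

/-- Transition maps on a tree determine a labeling with a prescribed label at the root `w`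
in which, along every edge, one label is the image of the other. -/
theorem SimpleGraph.IsTree.exists_labeling {W : Type*} {G : SimpleGraph W} (hG : G.IsTree)
    {S : W → Type*} (f : ∀ u v, G.Adj u v → S u → S v) (w : W) (s : S w) :
    ∃ y : ∀ u, S u, y w = s ∧ (∀ v (h : G.Adj w v), y v = f w v h s) ∧
      ∀ u v (h : G.Adj u v), y u = f v u h.symm (y v) ∨ y v = f u v h (y u) := by
  choose p hp using fun u => (hG.existsUnique_path u w).exists
  have hw : p w = .nil :=
    congrArg Subtype.val ((hG.isAcyclic.subsingleton_path w w).elim ⟨_, hp w⟩ .nil)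
  refine ⟨fun u => (p u).pullLabel f s, by simp only [hw, Walk.pullLabel], fun v h => ?_,
    fun u v h => ?_⟩
  · rcases hG.isAcyclic.eq_cons_or_eq_cons h (hp w) (hp v) with e | e
    · simp [hw] at e
    · simp only [e, hw, Walk.pullLabel]
  · rcases hG.isAcyclic.eq_cons_or_eq_cons h (hp u) (hp v) with e | e
    · exact .inl (by simp only [e, Walk.pullLabel])
    · exact .inr (by simp only [e, Walk.pullLabel])

/-- **On a tree, every 1-coordinate of an arc-consistent nonzero 0/1 vector is
contained in a globally consistent labeling.**  Here `ξv u s` means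
`ξ_u(s) = 1` and `ξe u v s t` means `ξ_{uv}(s,t) = 1`. -/
theorem statement_4 (G : SimpleGraph V) (hG : G.IsTree)
    (Y : V → Type) [∀ u, Fintype (Y u)] [∀ u, Nonempty (Y u)]
    (ξv : ∀ u, Y u → Prop) (ξe : ∀ u v, Y u → Y v → Prop)
    (hξsym : ∀ u v s t, ξe u v s t ↔ ξe v u t s)
    (hac1 : ∀ u v, G.Adj u v → ∀ s t, ξe u v s t → ξv u s ∧ ξv v t)
    (hac2 : ∀ u v, G.Adj u v → ∀ s, ξv u s → ∃ t, ξe u v s t)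
    (hnz : (∃ u, ∃ s, ξv u s) ∨ ∃ u v, G.Adj u v ∧ ∃ s t, ξe u v s t) :
    (∀ (w : V) (s : Y w), ξv w s →
      ∃ y : ∀ u, Y u, y w = s ∧ (∀ u, ξv u (y u)) ∧
        ∀ u v, G.Adj u v → ξe u v (y u) (y v)) ∧
    (∀ (u v : V), G.Adj u v → ∀ (s : Y u) (t : Y v), ξe u v s t →
      ∃ y : ∀ w, Y w, y u = s ∧ y v = t ∧ (∀ w, ξv w (y w)) ∧
        ∀ w w', G.Adj w w' → ξe w w' (y w) (y w')) := by
  have key : ∀ f : ∀ u v, G.Adj u v → {s // ξv u s} → {t // ξv v t},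
      (∀ u v h s, ξe u v s.1 (f u v h s).1) → ∀ w (s : {s // ξv w s}),
      ∃ y : ∀ u, Y u, y w = s.1 ∧ (∀ v (h : G.Adj w v), y v = (f w v h s).1) ∧
        (∀ u, ξv u (y u)) ∧ ∀ u v, G.Adj u v → ξe u v (y u) (y v) := by
    intro f hf w s
    obtain ⟨y, hw, hy, he⟩ := hG.exists_labeling f w s
    refine ⟨fun u => (y u).1, congrArg _ hw, fun v h => congrArg _ (hy v h),
      fun u => (y u).2, fun u v h => ?_⟩
    rcases he u v h with e | e
    · rw [hξsym]
      dsimp only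
      rw [e]
      exact hf v u h.symm (y v)
    · dsimp only
      rw [e]
      exact hf u v h (y u)
  have step : ∀ u v, G.Adj u v → ∀ s : {s // ξv u s}, ∃ t : {t // ξv v t}, ξe u v s.1 t.1 :=
    fun u v h s =>
      let ⟨t, ht⟩ := hac2 u v h s.1 s.2
      ⟨⟨t, (hac1 u v h _ _ ht).2⟩, ht⟩
  choose f hf using step
  refine ⟨fun w s hs => ?_, fun u v h s t hst => ?_⟩
  · obtain ⟨y, hw, -, hy⟩ := key f hf w ⟨s, hs⟩
    exact ⟨y, hw, hy⟩
  · obtain ⟨hs, ht⟩ := hac1 u v h s t hst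
    have step' : ∀ a b, G.Adj a b → ∀ r : {r // ξv a r}, ∃ q : {q // ξv b q}, ξe a b r.1 q.1 ∧
        (a = u → HEq r.1 s → b = v → HEq q.1 t) := by
      intro a b hab r
      by_cases hc : a = u ∧ HEq r.1 s ∧ b = v
      · obtain ⟨rfl, hr, rfl⟩ := hc
        exact ⟨⟨t, ht⟩, by rwa [eq_of_heq hr], fun _ _ _ => HEq.rfl⟩
      · exact ⟨f a b hab r, hf a b hab r, fun h₁ h₂ h₃ => (hc ⟨h₁, h₂, h₃⟩).elim⟩
    choose g hg hgt using step'
    obtain ⟨y, hu, hv, hy⟩ := key g hg u ⟨s, hs⟩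
    exact ⟨y, hu, (hv v h).trans (eq_of_heq (hgt u v h ⟨s, hs⟩ rfl HEq.rfl rfl)), hy⟩
end

section
/- If the graph G of a pairwise graphical model is acyclic (contains no cycles), then the local polytope equals the marginal polytope: L = conv{δ(y) : y a labeling}, i.e. the local polytope is exactly the convex hull of the binary vectors corresponding to labelings. -/
open Finset

variable {V : Type} [Fintype V] [DecidableEq V]

/-- The 0/1 vector `δ(y)` corresponding to a labeling `y`. -/
def deltaVec (G : SimpleGraph V) [DecidableRel G.Adj]
    (Y : V → Type) [∀ u, DecidableEq (Y u)] (y : ∀ u, Y u) :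
    (∀ u, Y u → ℝ) × (∀ u v, Y u → Y v → ℝ) :=
  (fun u s => if y u = s then (1 : ℝ) else 0,
   fun u v s t => if G.Adj u v ∧ y u = s ∧ y v = t then (1 : ℝ) else 0)

/-- A nonempty finite forest has a vertex with at most one neighbour; here for the forest induced
on a finite set of vertices. -/
theorem SimpleGraph.IsAcyclic.exists_mem_neighbors_subsingleton {α : Type*} {G : SimpleGraph α}
    (hG : G.IsAcyclic) {S : Finset α} (hS : S.Nonempty) :
    ∃ v ∈ S, ∀ a ∈ S, ∀ b ∈ S, G.Adj v a → G.Adj v b → a = b := by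
  have hH : (G.induce (S : Set α)).IsAcyclic := hG.induce _
  have : Nonempty (S : Set α) := hS.to_subtype
  obtain ⟨u, v, p, hp, hmax⟩ :=
    SimpleGraph.Walk.exists_isPath_forall_isPath_length_le_length (G.induce (S : Set α))
  have key : ∀ a : (S : Set α), (G.induce (S : Set α)).Adj u a → a = p.snd := by
    intro a ha
    refine hH.eq_snd_of_adj_start hp ha ?_
    by_contra hna
    have := hmax _ _ (.cons ha.symm p) (hp.cons hna)
    simp at this
  refine ⟨u, u.2, fun a ha b hb hua hub => ?_⟩
  exact congrArg Subtype.val ((key ⟨a, ha⟩ hua).trans (key ⟨b, hb⟩ hub).symm)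

/-- Resampling the coordinate `v` of a weighted labeling according to a kernel `K`. -/
theorem exists_weight_update {Y : V → Type} [∀ u, Fintype (Y u)] [∀ u, DecidableEq (Y u)]
    {w : (∀ u, Y u) → ℝ} (hw : ∀ y, 0 ≤ w y) (v : V) {K : (∀ u, Y u) → Y v → ℝ}
    (hK : ∀ z t, 0 ≤ K z t) :
    ∃ w' : (∀ u, Y u) → ℝ, (∀ y, 0 ≤ w' y) ∧ ∀ f : (∀ u, Y u) → ℝ,
      ∑ y, w' y * f y = ∑ z, ∑ t, w z * K z t * f (Function.update z v t) := by
  refine ⟨fun y => ∑ z, ∑ t, if Function.update z v t = y then w z * K z t else 0,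
    fun y => ?_, fun f => ?_⟩
  · refine sum_nonneg fun z _ => sum_nonneg fun t _ => ?_
    split_ifs
    exacts [mul_nonneg (hw z) (hK z t), le_rfl]
  · simp only [sum_mul]
    rw [sum_comm]
    refine sum_congr rfl fun z _ => ?_
    rw [sum_comm]
    refine sum_congr rfl fun t _ => ?_
    simp [ite_mul]

/-- `w` is a probability weight on labelings whose unary and pairwise marginals on the vertex set
`S` are given by `μv` and `μe`. -/
def HasMarginalsOn (G : SimpleGraph V) (Y : V → Type) [∀ u, Fintype (Y u)]
    [∀ u, DecidableEq (Y u)] (μv : ∀ u, Y u → ℝ) (μe : ∀ u v, Y u → Y v → ℝ) (S : Finset V)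
    (w : (∀ u, Y u) → ℝ) : Prop :=
  (∀ y, 0 ≤ w y) ∧ ∑ y, w y = 1 ∧
  (∀ u ∈ S, ∀ s, ∑ y, w y * (if y u = s then 1 else 0) = μv u s) ∧
  (∀ u ∈ S, ∀ v ∈ S, G.Adj u v → ∀ s t,
    ∑ y, w y * (if y u = s ∧ y v = t then 1 else 0) = μe u v s t)

theorem HasMarginalsOn.exists_insert {G : SimpleGraph V} {Y : V → Type} [∀ u, Fintype (Y u)]
    [∀ u, DecidableEq (Y u)] {μv : ∀ u, Y u → ℝ} {μe : ∀ u v, Y u → Y v → ℝ} {S : Finset V}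
    {w : (∀ u, Y u) → ℝ} (h : HasMarginalsOn G Y μv μe S w)
    (hsymm : ∀ u v s t, μe u v s t = μe v u t s) {v : V} (hv : v ∉ S)
    {K : (∀ u, Y u) → Y v → ℝ} (hK : ∀ z t, 0 ≤ K z t)
    (hsum : ∀ z, ∑ t, w z * K z t = w z) (hunary : ∀ t, ∑ z, w z * K z t = μv v t)
    (hpair : ∀ u ∈ S, G.Adj u v → ∀ s t,
      ∑ z, w z * K z t * (if z u = s then 1 else 0) = μe u v s t) :
    ∃ w', HasMarginalsOn G Y μv μe (insert v S) w' := by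
  obtain ⟨hw0, hw1, hwv, hwe⟩ := h
  obtain ⟨w', hnonneg, hw'⟩ := exists_weight_update hw0 v hK
  have hkeep : ∀ f : (∀ u, Y u) → ℝ, (∀ z t, f (Function.update z v t) = f z) →
      ∑ y, w' y * f y = ∑ y, w y * f y := by
    intro f hf
    simp only [hw', hf, ← sum_mul, hsum]
  have hne : ∀ u ∈ S, u ≠ v := fun u hu huv => hv (huv ▸ hu)
  have hnew : ∀ u ∈ S, G.Adj u v → ∀ s t,
      ∑ y, w' y * (if y u = s ∧ y v = t then 1 else 0) = μe u v s t := by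
    intro u hu huv s t
    rw [← hpair u hu huv, hw']
    refine sum_congr rfl fun z _ => ?_
    simp [Function.update_of_ne (hne u hu), ite_and]
  refine ⟨w', hnonneg, ?_, ?_, ?_⟩
  · simpa [hw1] using hkeep (fun _ => 1) (fun _ _ => rfl)
  · intro u hu s
    rcases mem_insert.1 hu with rfl | hu
    · rw [hw', ← hunary]
      simp
    · rw [hkeep _ (fun z t => by simp [Function.update_of_ne (hne u hu)]), hwv u hu]
  · intro a ha b hb hab s t
    rcases mem_insert.1 ha with rfl | haS <;> rcases mem_insert.1 hb with rfl | hbS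
    · exact (hab.ne rfl).elim
    · simp only [hsymm a b, and_comm (a := _ = s)]
      exact hnew b hbS hab.symm t s
    · exact hnew a haS hab s t
    · rw [hkeep _ (fun z t => by
        simp [Function.update_of_ne (hne a haS), Function.update_of_ne (hne b hbS)]),
        hwe a haS b hbS hab]

theorem memLocal.exists_hasMarginalsOn {G : SimpleGraph V} [DecidableRel G.Adj] (hG : G.IsAcyclic)
    {Y : V → Type} [∀ u, Fintype (Y u)] [∀ u, Nonempty (Y u)] [∀ u, DecidableEq (Y u)]
    {μv : ∀ u, Y u → ℝ} {μe : ∀ u v, Y u → Y v → ℝ} (hμ : memLocal G Y μv μe) (S : Finset V) :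
    ∃ w, HasMarginalsOn G Y μv μe S w := by
  obtain ⟨hv0, he0, hsymm, -, hv1, hcv, hcu⟩ := hμ
  induction S using Finset.strongInduction with
  | H S ih =>
  rcases S.eq_empty_or_nonempty with rfl | hS
  · obtain ⟨y₀⟩ : Nonempty (∀ u, Y u) := inferInstance
    refine ⟨fun y => if y = y₀ then 1 else 0, fun y => ?_, ?_, ?_, ?_⟩
    · dsimp only
      split_ifs <;> norm_num
    all_goals simp
  obtain ⟨v, hvS, huniq⟩ := hG.exists_mem_neighbors_subsingleton hS
  obtain ⟨w, hw⟩ := ih (S.erase v) (erase_ssubset hvS)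
  have hvn : v ∉ S.erase v := notMem_erase v S
  rw [← insert_erase hvS]
  obtain ⟨hw0, hw1, hwv, -⟩ := id hw
  by_cases hnb : ∃ u ∈ S.erase v, G.Adj u v
  · obtain ⟨u, hu, huv⟩ := hnb
    have hnull : ∀ z, μv u (z u) = 0 → w z = 0 := by
      intro z hz
      rw [← hwv u hu] at hz
      simpa using (sum_eq_zero_iff_of_nonneg fun y _ =>
        mul_nonneg (hw0 y) (by split_ifs <;> norm_num)).1 hz z (mem_univ z)
    have hzero : ∀ s t, μv u s = 0 → μe u v s t = 0 := by
      intro s t hs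
      rw [← hcu u v huv] at hs
      exact (sum_eq_zero_iff_of_nonneg fun t _ => he0 u v huv s t).1 hs t (mem_univ t)
    have hpair : ∀ s t, ∑ z, w z * (μe u v (z u) t / μv u (z u)) * (if z u = s then 1 else 0) =
        μe u v s t := by
      intro s t
      have : ∀ z, w z * (μe u v (z u) t / μv u (z u)) * (if z u = s then 1 else 0) =
          w z * (if z u = s then 1 else 0) * (μe u v s t / μv u s) := by
        intro z
        split_ifs with h
        · simp [h]
        · simp
      rw [sum_congr rfl fun z _ => this z, ← sum_mul, hwv u hu]
      exact mul_div_cancel_of_imp' (hzero s t)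
    refine hw.exists_insert hsymm hvn (K := fun z t => μe u v (z u) t / μv u (z u))
      (fun z t => div_nonneg (he0 u v huv _ _) (hv0 _ _)) ?_ ?_ ?_
    · intro z
      rw [← mul_sum, ← sum_div, hcu u v huv]
      by_cases h : μv u (z u) = 0
      · simp [hnull z h]
      · rw [div_self h, mul_one]
    · intro t
      rw [← hcv u v huv, ← sum_congr rfl fun s _ => hpair s t, sum_comm]
      simp
    · intro u' hu' hu'v s t
      obtain rfl := huniq u' (mem_of_mem_erase hu') u (mem_of_mem_erase hu) hu'v.symm huv.symm
      exact hpair s t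
  · push Not at hnb
    refine hw.exists_insert hsymm hvn (K := fun _ t => μv v t) (fun _ t => hv0 v t) ?_ ?_ ?_
    · intro z
      rw [← mul_sum, hv1, mul_one]
    · intro t
      rw [← sum_mul, hw1, one_mul]
    · exact fun u hu huv => (hnb u hu huv).elim

theorem memLocal_deltaVec {W : Type} (G : SimpleGraph W) [DecidableRel G.Adj] {Y : W → Type}
    [∀ u, Fintype (Y u)] [∀ u, DecidableEq (Y u)] (y : ∀ u, Y u) :
    memLocal G Y (deltaVec G Y y).1 (deltaVec G Y y).2 := by
  refine ⟨?_, ?_, ?_, ?_, ?_, ?_, ?_⟩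
  · intro u s
    simp only [deltaVec]
    split_ifs <;> norm_num
  · intro u v _ s t
    simp only [deltaVec]
    split_ifs <;> norm_num
  · intro u v s t
    simp only [deltaVec, G.adj_comm u v, and_comm (a := y u = s)]
  · intro u v h s t
    simp [deltaVec, h]
  · intro u
    simp [deltaVec]
  · intro u v h t
    simp [deltaVec, h, ite_and]
  · intro u v h s
    simp [deltaVec, h, ite_and]

theorem convex_setOf_memLocal {W : Type} (G : SimpleGraph W) [DecidableRel G.Adj] (Y : W → Type)
    [∀ u, Fintype (Y u)] :
    Convex ℝ {μ : (∀ u, Y u → ℝ) × (∀ u v, Y u → Y v → ℝ) | memLocal G Y μ.1 μ.2} := by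
  rintro ⟨μv, μe⟩ ⟨h1, h2, h3, h4, h5, h6, h7⟩ ⟨νv, νe⟩ ⟨k1, k2, k3, k4, k5, k6, k7⟩ a b ha hb hab
  dsimp only at *
  refine ⟨?_, ?_, ?_, ?_, ?_, ?_, ?_⟩ <;>
    simp only [Prod.smul_mk, Prod.mk_add_mk, Pi.add_apply, Pi.smul_apply, smul_eq_mul,
      sum_add_distrib, ← mul_sum]
  · exact fun u s => add_nonneg (mul_nonneg ha (h1 u s)) (mul_nonneg hb (k1 u s))
  · exact fun u v h s t =>
      add_nonneg (mul_nonneg ha (h2 u v h s t)) (mul_nonneg hb (k2 u v h s t))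
  · intro u v s t
    rw [h3, k3]
  · intro u v h s t
    rw [h4 u v h, k4 u v h, mul_zero, mul_zero, add_zero]
  · intro u
    rw [h5, k5, mul_one, mul_one, hab]
  · intro u v h t
    rw [h6 u v h, k6 u v h]
  · intro u v h s
    rw [h7 u v h, k7 u v h]

/-- **For acyclic graphs the local polytope equals the marginal polytope**,
i.e. the convex hull of the 0/1 vectors `δ(y)` corresponding to labelings. -/
theorem statement_5 (G : SimpleGraph V) [DecidableRel G.Adj] (hG : G.IsAcyclic)
    (Y : V → Type) [∀ u, Fintype (Y u)] [∀ u, Nonempty (Y u)] [∀ u, DecidableEq (Y u)] :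
    {μ : (∀ u, Y u → ℝ) × (∀ u v, Y u → Y v → ℝ) | memLocal G Y μ.1 μ.2} =
      convexHull ℝ (Set.range (deltaVec G Y)) := by
  refine Set.Subset.antisymm ?_ (convexHull_min ?_ (convex_setOf_memLocal G Y))
  · rintro ⟨μv, μe⟩ hμ
    obtain ⟨w, hw0, hw1, hwv, hwe⟩ := memLocal.exists_hasMarginalsOn hG hμ univ
    obtain ⟨-, -, -, hoff, -⟩ := hμ
    refine mem_convexHull_of_exists_fintype w (deltaVec G Y) hw0 hw1 (fun y => ⟨y, rfl⟩) ?_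
    refine Prod.ext ?_ ?_
    · ext u s
      simpa [Prod.fst_sum, Finset.sum_apply, deltaVec] using hwv u (mem_univ u) s
    · ext u v s t
      by_cases h : G.Adj u v
      · simpa [Prod.snd_sum, Finset.sum_apply, deltaVec, h] using
          hwe u (mem_univ u) v (mem_univ v) h s t
      · simpa [Prod.snd_sum, Finset.sum_apply, deltaVec, h] using (hoff u v h s t).symm
  · rintro _ ⟨y, rfl⟩
    exact memLocal_deltaVec G y
end

section
/- Let f : ℝ^n → ℝ and ε : ℝ^n → ℝ be continuous with ε(x) ≥ 0 for all x, and let F : ℝ^n → ℝ^n be continuous. Assume: (i) f(F(x)) ≥ f(x) for all x ∈ ℝ^n; (ii) for every x there exists M ∈ ℝ such that f(Fⁱ(x)) < M for every i; (iii) for every x there exists C > 0 such that ‖Fⁱ(x)‖ ≤ C for every i; (iv) for every x there exists M' ∈ ℝ such that ε(Fⁱ(x)) < M' for every i; (v) there exists a natural number N > 0 such that for every x, f(F^N(x)) = f(x) implies ε(x) = 0. Then for every x ∈ ℝ^n the sequence ε(Fⁱ(x)) converges to 0 as i → ∞. -/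
/-- **Abstract convergence theorem for consistency-enforcing mappings.**
If `f, ε : ℝⁿ → ℝ` are continuous, `ε ≥ 0`, `F : ℝⁿ → ℝⁿ` is continuous and
(i) monotone w.r.t. `f`, (ii) bounded w.r.t. `f` along orbits, (iii) has
bounded orbits, (iv) is bounded w.r.t. `ε` along orbits and (v) for some
`N > 0`, `f(F^N(x)) = f(x)` implies `ε(x) = 0`, then `ε(Fⁱ(x)) → 0` as
`i → ∞` for every starting point `x`. -/
theorem statement_6 (n : ℕ)
    (f ε : EuclideanSpace ℝ (Fin n) → ℝ)
    (F : EuclideanSpace ℝ (Fin n) → EuclideanSpace ℝ (Fin n))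
    (hf : Continuous f) (hε : Continuous ε) (hε0 : ∀ x, 0 ≤ ε x)
    (hF : Continuous F)
    (h1 : ∀ x, f x ≤ f (F x))
    (h2 : ∀ x, ∃ M : ℝ, ∀ i : ℕ, f (F^[i] x) < M)
    (h3 : ∀ x, ∃ C : ℝ, 0 < C ∧ ∀ i : ℕ, ‖F^[i] x‖ ≤ C)
    (h4 : ∀ x, ∃ M' : ℝ, ∀ i : ℕ, ε (F^[i] x) < M')
    (h5 : ∃ N : ℕ, 0 < N ∧ ∀ x, f (F^[N] x) = f x → ε x = 0) :
    ∀ x, Filter.Tendsto (fun i : ℕ => ε (F^[i] x)) Filter.atTop (nhds 0) := by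
  intro x
  obtain ⟨N, -, hN⟩ := h5
  obtain ⟨M, hM⟩ := h2 x
  obtain ⟨C, -, hC⟩ := h3 x
  have hmono : Monotone fun i : ℕ => f (F^[i] x) :=
    monotone_nat_of_le_succ fun i => by
      rw [Function.iterate_succ_apply']
      exact h1 _
  have hlim := tendsto_atTop_ciSup hmono
    ⟨M, Set.forall_mem_range.2 fun i => (hM i).le⟩
  refine Filter.tendsto_of_subseq_tendsto fun ns hns => ?_
  obtain ⟨y, -, φ, hφ, hy⟩ := (isCompact_closedBall
    (0 : EuclideanSpace ℝ (Fin n)) C).tendsto_subseq (x := fun k => F^[ns k] x)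
    fun k => mem_closedBall_zero_iff.2 (hC (ns k))
  have hidx : Filter.Tendsto (fun k => ns (φ k)) Filter.atTop Filter.atTop :=
    hns.comp hφ.tendsto_atTop
  have hfy := tendsto_nhds_unique ((hf.tendsto y).comp hy) (hlim.comp hidx)
  have hshift : Filter.Tendsto (fun k => f (F^[N] (F^[ns (φ k)] x))) Filter.atTop
      (nhds (⨆ i : ℕ, f (F^[i] x))) := by
    simp only [← Function.iterate_add_apply]
    exact hlim.comp (Filter.tendsto_atTop_mono (fun k => Nat.le_add_left _ N) hidx)
  have hfNy := tendsto_nhds_unique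
    (((hf.comp (hF.iterate N)).tendsto y).comp hy) hshift
  have hεy : ε y = 0 := hN y (hfNy.trans hfy.symm)
  exact ⟨φ, hεy ▸ (hε.tendsto y).comp hy⟩
end

section
/- Fix a node u ∈ V and nonnegative weights ω_{u,v} ≥ 0 for each neighbor v of u with Σ_{v: uv∈E} ω_{u,v} ≤ 1. Given a reparametrization φ, define ψ by ψ_{u,v}(s) = φ_{u,v}(s) − min_{t∈Y_v} θ^φ_{uv}(s,t) for every neighbor v of u and s ∈ Y_u, with all other coordinates of ψ equal to those of φ; then define φ' by φ'_{u,v}(s) = ψ_{u,v}(s) + ω_{u,v} · θ^ψ_u(s) for every neighbor v of u and s ∈ Y_u, with all other coordinates of φ' equal to those of ψ. Then φ' maximizes the Lagrange dual D over the block of variables attached to u: D(φ') ≥ D(φ'') for every reparametrization φ'' that agrees with φ on all coordinates except possibly the coordinates φ_{u,v}(s) with uv ∈ E and s ∈ Y_u. -/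
open Finset

variable {V : Type} [Fintype V] [DecidableEq V]

theorem le_fmin {α : Type*} [Fintype α] [Nonempty α] {f : α → ℝ} {c : ℝ} (h : ∀ a, c ≤ f a) :
    c ≤ fmin f :=
  Finset.le_inf' _ _ fun a _ => h a

/-- A symmetric array that vanishes off the cross through `a` and at its centre has total sum twice
the sum of row `a`. -/
theorem sum_sum_eq_two_mul_of_symm {ι : Type*} [Fintype ι] [DecidableEq ι] (f : ι → ι → ℝ) (a : ι)
    (hsymm : ∀ u v, f u v = f v u) (haa : f a a = 0) (hoff : ∀ u v, u ≠ a → v ≠ a → f u v = 0) :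
    ∑ u, ∑ v, f u v = 2 * ∑ v, f a v := by
  have h : ∀ u v, f u v = (if u = a then f a v else 0) + (if v = a then f a u else 0) := by
    intro u v
    by_cases hu : u = a <;> by_cases hv : v = a
    · subst hu hv; simp [haa]
    · simp [hu, hv]
    · simp [hu, hv, hsymm u a]
    · simp [hu, hv, hoff u v hu hv]
  rw [Finset.sum_congr rfl fun u _ => Finset.sum_congr rfl fun v _ => h u v]
  simp only [Finset.sum_add_distrib, Finset.sum_ite_eq', Finset.mem_univ, if_true]
  rw [Finset.sum_comm]
  simp only [Finset.sum_ite_eq', Finset.mem_univ, if_true]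
  ring

omit [Fintype V] [DecidableEq V] in
theorem repPair_swap (Y : V → Type) (θe : ∀ u v, Y u → Y v → ℝ)
    (hθsym : ∀ u v s t, θe u v s t = θe v u t s) (φ : ∀ (u v : V), Y u → ℝ)
    (u v : V) (s : Y u) (t : Y v) : repPair Y θe φ u v s t = repPair Y θe φ v u t s := by
  unfold repPair
  rw [hθsym u v s t]
  ring

omit [Fintype V] [DecidableEq V] in
theorem fmin_repPair_swap (Y : V → Type) [∀ u, Fintype (Y u)] [∀ u, Nonempty (Y u)]
    (θe : ∀ u v, Y u → Y v → ℝ) (hθsym : ∀ u v s t, θe u v s t = θe v u t s)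
    (φ : ∀ (u v : V), Y u → ℝ) (u v : V) :
    fmin (fun p : Y u × Y v => repPair Y θe φ u v p.1 p.2) =
      fmin (fun p : Y v × Y u => repPair Y θe φ v u p.1 p.2) := by
  apply le_antisymm <;> refine le_fmin fun p => ?_ <;> rw [repPair_swap Y θe hθsym]
  · exact fmin_le (fun p : Y u × Y v => repPair Y θe φ u v p.1 p.2) p.swap
  · exact fmin_le (fun p : Y v × Y u => repPair Y θe φ v u p.1 p.2) p.swap

/-- The part of the Lagrange dual that depends on the block of variables attached to `u`. -/
noncomputable def blockDual (G : SimpleGraph V) [DecidableRel G.Adj]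
    (Y : V → Type) [∀ u, Fintype (Y u)] [∀ u, Nonempty (Y u)]
    (θv : ∀ u, Y u → ℝ) (θe : ∀ u v, Y u → Y v → ℝ)
    (φ : ∀ (u v : V), Y u → ℝ) (u : V) : ℝ :=
  fmin (fun s : Y u => repUnary G Y θv φ u s) +
    ∑ v, if G.Adj u v then fmin (fun p : Y u × Y v => repPair Y θe φ u v p.1 p.2) else 0

theorem dualD_sub_dualD (G : SimpleGraph V) [DecidableRel G.Adj]
    (Y : V → Type) [∀ u, Fintype (Y u)] [∀ u, Nonempty (Y u)]
    (θv : ∀ u, Y u → ℝ) (θe : ∀ u v, Y u → Y v → ℝ)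
    (hθsym : ∀ u v s t, θe u v s t = θe v u t s) (u0 : V) (φ χ : ∀ (u v : V), Y u → ℝ)
    (h : ∀ u v, ¬ (u = u0 ∧ G.Adj u v) → ∀ s, φ u v s = χ u v s) :
    dualD G Y θv θe φ - dualD G Y θv θe χ =
      blockDual G Y θv θe φ u0 - blockDual G Y θv θe χ u0 := by
  classical
  have hU : (∑ u, fmin (fun s : Y u => repUnary G Y θv φ u s)) -
      (∑ u, fmin (fun s : Y u => repUnary G Y θv χ u s)) =
      fmin (fun s : Y u0 => repUnary G Y θv φ u0 s) -
        fmin (fun s : Y u0 => repUnary G Y θv χ u0 s) := by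
    rw [← Finset.sum_sub_distrib]
    refine Finset.sum_eq_single u0 (fun u _ hu => ?_) (fun hu => absurd (Finset.mem_univ _) hu)
    simp only [repUnary, h u _ (fun hh => hu hh.1), sub_self]
  have hE := sum_sum_eq_two_mul_of_symm (fun u v =>
    (if G.Adj u v then fmin (fun p : Y u × Y v => repPair Y θe φ u v p.1 p.2) else 0) -
      (if G.Adj u v then fmin (fun p : Y u × Y v => repPair Y θe χ u v p.1 p.2) else 0)) u0
    (fun u v => by
      simp only [G.adj_comm u v, fmin_repPair_swap Y θe hθsym _ u v])
    (by simp)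
    (fun u v hu hv => by
      simp only [repPair, h u v (fun hh => hu hh.1), h v u (fun hh => hv hh.1), sub_self])
  simp only [Finset.sum_sub_distrib] at hE
  unfold dualD blockDual
  linarith

/-- **The anisotropic diffusion update is a block-coordinate ascent step.**
Fix a node `u0` and weights `ω_{u0,v} ≥ 0` summing to at most `1` over the
neighbors of `u0`.  Starting from `φ`, first subtract from each coordinate
`φ_{u0,v}(s)` the minimal reparametrized pairwise cost in the pencil `(s,u0,v)`
(giving `ψ`), then add the fraction `ω_{u0,v}` of the reparametrized unary cost
`θ^ψ_{u0}(s)` (giving `φ'`); all other coordinates stay unchanged.  Then `φ'`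
maximizes the Lagrange dual `D` over the block of coordinates attached to
`u0`. -/
theorem statement_7 (G : SimpleGraph V) [DecidableRel G.Adj]
    (Y : V → Type) [∀ u, Fintype (Y u)] [∀ u, Nonempty (Y u)]
    (θv : ∀ u, Y u → ℝ) (θe : ∀ u v, Y u → Y v → ℝ)
    (hθsym : ∀ u v s t, θe u v s t = θe v u t s)
    (u0 : V) (ω : V → ℝ) (hω0 : ∀ v, G.Adj u0 v → 0 ≤ ω v)
    (hω1 : (∑ v, if G.Adj u0 v then ω v else 0) ≤ 1)
    (φ ψ φ' : ∀ (u v : V), Y u → ℝ)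
    (hψ1 : ∀ v, G.Adj u0 v → ∀ s : Y u0,
      ψ u0 v s = φ u0 v s - fmin (fun t : Y v => repPair Y θe φ u0 v s t))
    (hψ2 : ∀ u v, ¬ (u = u0 ∧ G.Adj u v) → ∀ s, ψ u v s = φ u v s)
    (hφ'1 : ∀ v, G.Adj u0 v → ∀ s : Y u0,
      φ' u0 v s = ψ u0 v s + ω v * repUnary G Y θv ψ u0 s)
    (hφ'2 : ∀ u v, ¬ (u = u0 ∧ G.Adj u v) → ∀ s, φ' u v s = ψ u v s) :
    ∀ φ'' : ∀ (u v : V), Y u → ℝ,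
      (∀ u v, ¬ (u = u0 ∧ G.Adj u v) → ∀ s, φ'' u v s = φ u v s) →
      dualD G Y θv θe φ'' ≤ dualD G Y θv θe φ' := by
  intro φ'' hφ''
  have hoff : ∀ u v, ¬ (u = u0 ∧ G.Adj u v) → ∀ s, φ'' u v s = φ' u v s := fun u v h s => by
    rw [hφ'' u v h, hφ'2 u v h, hψ2 u v h]
  have hback : ∀ v, G.Adj u0 v → ∀ t, φ'' v u0 t = ψ v u0 t ∧ φ' v u0 t = ψ v u0 t ∧
      ψ v u0 t = φ v u0 t := fun v hv t => by
    have h : ¬ (v = u0 ∧ G.Adj v u0) := fun h => hv.ne h.1.symm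
    exact ⟨by rw [hφ'' v u0 h, hψ2 v u0 h], hφ'2 v u0 h t, hψ2 v u0 h t⟩
  have hpair : ∀ v, G.Adj u0 v → ∀ s t, repPair Y θe ψ u0 v s t =
      repPair Y θe φ u0 v s t - fmin (fun t : Y v => repPair Y θe φ u0 v s t) :=
    fun v hv s t => by
      simp only [repPair, hψ1 v hv, (hback v hv t).2.2]
      ring
  obtain ⟨s₀, hs₀⟩ := exists_eq_fmin (fun s : Y u0 => repUnary G Y θv ψ u0 s)
  have hmin : ∀ s, repUnary G Y θv ψ u0 s₀ ≤ repUnary G Y θv ψ u0 s := fun s =>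
    hs₀.trans_le (fmin_le _ s)
  have hupper : blockDual G Y θv θe φ'' u0 ≤ repUnary G Y θv ψ u0 s₀ := by
    have hU := fmin_le (fun s : Y u0 => repUnary G Y θv φ'' u0 s) s₀
    have hE : (∑ v, if G.Adj u0 v then
        fmin (fun p : Y u0 × Y v => repPair Y θe φ'' u0 v p.1 p.2) else 0) ≤
        ∑ v, ((if G.Adj u0 v then φ'' u0 v s₀ else 0) - if G.Adj u0 v then ψ u0 v s₀ else 0) := by
      refine Finset.sum_le_sum fun v _ => ?_
      split_ifs with hv
      · obtain ⟨t, ht⟩ := exists_eq_fmin (fun t : Y v => repPair Y θe φ u0 v s₀ t)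
        have h1 := fmin_le (fun p : Y u0 × Y v => repPair Y θe φ'' u0 v p.1 p.2) (s₀, t)
        have h2 := hpair v hv s₀ t
        have h3 := (hback v hv t).1
        rw [← ht, sub_self] at h2
        simp only [repPair] at h1 h2 ⊢
        linarith
      · simp
    rw [Finset.sum_sub_distrib] at hE
    unfold blockDual
    simp only [repUnary] at hU ⊢
    linarith
  have hlower : repUnary G Y θv ψ u0 s₀ ≤ blockDual G Y θv θe φ' u0 := by
    have hU : (1 - ∑ v, if G.Adj u0 v then ω v else 0) * repUnary G Y θv ψ u0 s₀ ≤
        fmin (fun s : Y u0 => repUnary G Y θv φ' u0 s) := by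
      refine le_fmin fun s => ?_
      have hsum : (∑ v, if G.Adj u0 v then φ' u0 v s else 0) =
          (∑ v, if G.Adj u0 v then ψ u0 v s else 0) +
            (∑ v, if G.Adj u0 v then ω v else 0) * repUnary G Y θv ψ u0 s := by
        rw [Finset.sum_mul, ← Finset.sum_add_distrib]
        refine Finset.sum_congr rfl fun v _ => ?_
        split_ifs with hv
        · exact hφ'1 v hv s
        · simp
      have hrep : repUnary G Y θv φ' u0 s =
          (1 - ∑ v, if G.Adj u0 v then ω v else 0) * repUnary G Y θv ψ u0 s := by
        rw [one_sub_mul, repUnary, hsum, sub_add_eq_sub_sub]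
        rfl
      rw [hrep]
      exact mul_le_mul_of_nonneg_left (hmin s) (sub_nonneg.2 hω1)
    have hE : (∑ v, if G.Adj u0 v then ω v else 0) * repUnary G Y θv ψ u0 s₀ ≤
        ∑ v, if G.Adj u0 v then
          fmin (fun p : Y u0 × Y v => repPair Y θe φ' u0 v p.1 p.2) else 0 := by
      rw [Finset.sum_mul]
      refine Finset.sum_le_sum fun v _ => ?_
      split_ifs with hv
      · refine le_fmin fun ⟨s, t⟩ => ?_
        have h1 := hpair v hv s t
        have h2 := fmin_le (fun t : Y v => repPair Y θe φ u0 v s t) t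
        have h3 := mul_le_mul_of_nonneg_left (hmin s) (hω0 v hv)
        have h4 : repPair Y θe φ' u0 v s t =
            repPair Y θe ψ u0 v s t + ω v * repUnary G Y θv ψ u0 s := by
          simp only [repPair, hφ'1 v hv, (hback v hv t).2.1]
          ring
        simp only at h2 ⊢
        linarith
      · simp
    unfold blockDual
    linarith
  have := dualD_sub_dualD G Y θv θe hθsym u0 φ'' φ' hoff
  linarith
end

section
/- Let φ be any reparametrization with reparametrized costs θ^φ, and let ρ^τ_w ≥ 0 be given for every w ∈ V∪E and τ ∈ T_w with Σ_{τ∈T_w} ρ^τ_w = 1. Define the subgraph costs by θ^τ_w = ρ^τ_w · θ^φ_w for every τ ∈ T and every node or edge w of G^τ. Then the decomposition-based dual value dominates the Lagrange dual value: U(θ^T) ≥ D(φ), where D(φ) = Σ_{u∈V} min_{s∈Y_u} θ^φ_u(s) + Σ_{uv∈E} min_{(s,t)∈Y_u×Y_v} θ^φ_{uv}(s,t). -/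
open Finset

variable {V : Type} [Fintype V] [DecidableEq V]

theorem sum_weight_mul_eq {T : Type*} [Fintype T] {w : T → ℝ} (c : ℝ) (hw : ∑ τ, w τ = 1) :
    ∑ τ, w τ * c = c := by
  rw [← Finset.sum_mul, hw, one_mul]

/-- **Any decomposition-based dual built from a reparametrization dominates the
Lagrange dual.**  Given a decomposition of `G` into subgraphs `H τ` covering
all nodes and edges, nonnegative weights `ρ` supported on the decomposition and
summing to one on every node and every edge, and subgraph costs
`θ^τ_w = ρ^τ_w · θ^φ_w`, the decomposition-based dual value `U(θ^T)`
(the sum over `τ` of the minimal energy of the slave subproblem `τ`,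
each unordered edge of a slave counted once via the halved ordered sum) is at
least `D(φ)`. -/
theorem statement_8 (G : SimpleGraph V) [DecidableRel G.Adj]
    (Y : V → Type) [∀ u, Fintype (Y u)] [∀ u, Nonempty (Y u)]
    (θv : ∀ u, Y u → ℝ) (θe : ∀ u v, Y u → Y v → ℝ)
    (hθsym : ∀ u v s t, θe u v s t = θe v u t s)
    (T : Type) [Fintype T]
    (H : T → G.Subgraph)
    [∀ τ, DecidablePred (· ∈ (H τ).verts)] [∀ τ, DecidableRel (H τ).Adj]
    (hcovV : ∀ u : V, ∃ τ, u ∈ (H τ).verts)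
    (hcovE : ∀ u v : V, G.Adj u v → ∃ τ, (H τ).Adj u v)
    (φ : ∀ (u v : V), Y u → ℝ)
    (ρv : T → V → ℝ) (ρe : T → V → V → ℝ)
    (hρv0 : ∀ τ u, 0 ≤ ρv τ u) (hρe0 : ∀ τ u v, 0 ≤ ρe τ u v)
    (hρesym : ∀ τ u v, ρe τ u v = ρe τ v u)
    (hρvsupp : ∀ τ u, u ∉ (H τ).verts → ρv τ u = 0)
    (hρesupp : ∀ τ u v, ¬ (H τ).Adj u v → ρe τ u v = 0)
    (hρv1 : ∀ u : V, ∑ τ, ρv τ u = 1)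
    (hρe1 : ∀ u v : V, G.Adj u v → ∑ τ, ρe τ u v = 1) :
    dualD G Y θv θe φ ≤
      ∑ τ, fmin (fun y : ∀ u, Y u =>
        (∑ u, if u ∈ (H τ).verts then ρv τ u * repUnary G Y θv φ u (y u) else 0) +
          (∑ u, ∑ v, if (H τ).Adj u v then
              ρe τ u v * repPair Y θe φ u v (y u) (y v) else 0) / 2) := by
  have hV : ∀ u, fmin (fun s : Y u => repUnary G Y θv φ u s) =
      ∑ τ, ρv τ u * fmin (fun s : Y u => repUnary G Y θv φ u s) := fun u =>
    (sum_weight_mul_eq _ (hρv1 u)).symm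
  have hE : ∀ u v, (if G.Adj u v then
        fmin (fun p : Y u × Y v => repPair Y θe φ u v p.1 p.2) else 0) =
      ∑ τ, ρe τ u v * fmin (fun p : Y u × Y v => repPair Y θe φ u v p.1 p.2) := by
    intro u v
    split_ifs with h
    · exact (sum_weight_mul_eq _ (hρe1 u v h)).symm
    · exact (Finset.sum_eq_zero fun τ _ => by
        rw [hρesupp τ u v fun h' => h (h'.adj_sub), zero_mul]).symm
  have hD : dualD G Y θv θe φ = ∑ τ,
      ((∑ u, ρv τ u * fmin (fun s : Y u => repUnary G Y θv φ u s)) +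
        (∑ u, ∑ v, ρe τ u v *
          fmin (fun p : Y u × Y v => repPair Y θe φ u v p.1 p.2)) / 2) := by
    simp only [dualD, hE]
    rw [Finset.sum_congr rfl fun u _ => hV u, Finset.sum_add_distrib, ← Finset.sum_div]
    congr 1
    · exact Finset.sum_comm
    · rw [Finset.sum_comm (s := (Finset.univ : Finset T))]
      exact congrArg (· / 2) (Finset.sum_congr rfl fun u _ => Finset.sum_comm)
  rw [hD]
  refine Finset.sum_le_sum fun τ _ => le_fmin fun y => ?_
  gcongr with u _ u _ v _
  · split_ifs with h
    · exact mul_le_mul_of_nonneg_left (fmin_le _ (y u)) (hρv0 τ u)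
    · simp [hρvsupp τ u h]
  · split_ifs with h
    · exact mul_le_mul_of_nonneg_left
        (fmin_le (fun p : Y u × Y v => repPair Y θe φ u v p.1 p.2) (y u, y v)) (hρe0 τ u v)
    · simp [hρesupp τ u v h]
end

section
/- Suppose every node of the graph G has at least one incident edge. Then there exists a reparametrization φ that maximizes the Lagrange dual D (i.e. D(φ) = sup_{φ'} D(φ')) and for which all reparametrized unary costs vanish: θ^φ_u(s) = 0 for every node u ∈ V and every label s ∈ Y_u. -/
open Finset

variable {V : Type} [Fintype V] [DecidableEq V]

theorem fmin_add_const {α : Type*} [Fintype α] [Nonempty α] (f : α → ℝ) (c : ℝ) :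
    fmin (fun a => f a + c) = fmin f + c := by
  apply le_antisymm
  · obtain ⟨a, ha⟩ := exists_eq_fmin f
    rw [← ha]
    exact fmin_le (fun a => f a + c) a
  · exact le_fmin fun a => by linarith [fmin_le f a]

theorem continuous_fmin {X α : Type*} [TopologicalSpace X] [Fintype α] [Nonempty α]
    {f : X → α → ℝ} (hf : ∀ a, Continuous fun x => f x a) :
    Continuous fun x => fmin (f x) :=
  Continuous.finset_inf'_apply _ fun a _ => hf a

/-- Summing a symmetrized function over edges is summing it over ordered adjacent pairs. -/
theorem half_sum_adj_add_swap {V : Type} [Fintype V] (G : SimpleGraph V) [DecidableRel G.Adj]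
    (c : V → V → ℝ) :
    (∑ u, ∑ v, if G.Adj u v then c u v + c v u else 0) / 2 =
      ∑ u, ∑ v, if G.Adj u v then c u v else 0 := by
  have h : (∑ u, ∑ v, if G.Adj u v then c v u else 0) =
      ∑ u, ∑ v, if G.Adj u v then c u v else 0 := by
    rw [Finset.sum_comm]
    simp only [G.adj_comm]
  have h' : (∑ u, ∑ v, if G.Adj u v then c u v + c v u else 0) =
      (∑ u, ∑ v, if G.Adj u v then c u v else 0) +
        ∑ u, ∑ v, if G.Adj u v then c v u else 0 := by
    simp only [← Finset.sum_add_distrib]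
    refine Finset.sum_congr rfl fun u _ => Finset.sum_congr rfl fun v _ => ?_
    split_ifs <;> simp
  rw [h', h]
  ring

section Dual

variable {V : Type} [Fintype V] (G : SimpleGraph V) [DecidableRel G.Adj]
  (Y : V → Type) [∀ u, Fintype (Y u)] [∀ u, Nonempty (Y u)]
  (θv : ∀ u, Y u → ℝ) (θe : ∀ u v, Y u → Y v → ℝ)

theorem continuous_dualD : Continuous (dualD G Y θv θe) := by
  have happ : ∀ u v (s : Y u), Continuous fun φ : ∀ (u v : V), Y u → ℝ => φ u v s := by
    intro u v s
    fun_prop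
  unfold dualD
  refine Continuous.add (continuous_finsetSum _ fun u _ => ?_)
    (Continuous.div_const (continuous_finsetSum _ fun u _ =>
      continuous_finsetSum _ fun v _ => ?_) 2)
  · refine continuous_fmin fun s => ?_
    unfold repUnary
    refine continuous_const.sub (continuous_finsetSum _ fun v _ => ?_)
    split_ifs
    · exact happ u v s
    · exact continuous_const
  · split_ifs
    · refine continuous_fmin fun p => ?_
      unfold repPair
      exact (continuous_const.add (happ u v p.1)).add (happ v u p.2)
    · exact continuous_const

/-- The dual is invariant under subtracting constants from the messages, and does not see the
values of a reparametrization outside the edges. -/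
theorem dualD_sub_const (φ : ∀ (u v : V), Y u → ℝ) (c : V → V → ℝ) :
    dualD G Y θv θe (fun u v s => if G.Adj u v then φ u v s - c u v else 0) =
      dualD G Y θv θe φ := by
  set ψ : ∀ (u v : V), Y u → ℝ := fun u v s => if G.Adj u v then φ u v s - c u v else 0 with hψ
  have hun : ∀ u, fmin (fun s : Y u => repUnary G Y θv ψ u s) =
      fmin (fun s : Y u => repUnary G Y θv φ u s) + ∑ v, if G.Adj u v then c u v else 0 := by
    intro u
    rw [← fmin_add_const]
    congr 1
    funext s
    have h : (∑ v, if G.Adj u v then ψ u v s else 0) =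
        (∑ v, if G.Adj u v then φ u v s else 0) - ∑ v, if G.Adj u v then c u v else 0 := by
      rw [← Finset.sum_sub_distrib]
      refine Finset.sum_congr rfl fun v _ => ?_
      by_cases huv : G.Adj u v <;> simp [hψ, huv]
    simp only [repUnary, h]
    ring
  have hpair : (∑ u, ∑ v, if G.Adj u v then
        fmin (fun p : Y u × Y v => repPair Y θe ψ u v p.1 p.2) else 0) =
      (∑ u, ∑ v, if G.Adj u v then
        fmin (fun p : Y u × Y v => repPair Y θe φ u v p.1 p.2) else 0) -
      ∑ u, ∑ v, if G.Adj u v then c u v + c v u else 0 := by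
    simp only [← Finset.sum_sub_distrib]
    refine Finset.sum_congr rfl fun u _ => Finset.sum_congr rfl fun v _ => ?_
    by_cases huv : G.Adj u v
    · simp only [huv, if_true]
      rw [sub_eq_add_neg, ← fmin_add_const]
      congr 1
      funext p
      simp only [repPair, hψ, huv, huv.symm, if_true]
      ring
    · simp [huv]
  have hc := half_sum_adj_add_swap G c
  unfold dualD
  simp only [hun, hpair, Finset.sum_add_distrib]
  linarith

/-- On reparametrizations whose messages are nonnegative with minimum `0`, the dual tends to
`-∞` with the size of the messages. -/
theorem exists_dualD_le_sub : ∃ B : ℝ, ∀ ψ : ∀ (u v : V), Y u → ℝ,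
    (∀ u v s, 0 ≤ ψ u v s) → (∀ u v, ∃ s, ψ u v s = 0) →
    ∀ u v s, G.Adj u v → dualD G Y θv θe ψ ≤ B - ψ u v s := by
  classical
  refine ⟨(∑ u, -fmin (fun s => -θv u s)) + (∑ u, ∑ v, if G.Adj u v then
    -fmin (fun p : Y u × Y v => -θe u v p.1 p.2) else 0) / 2, ?_⟩
  intro ψ hnn hz u₀ v₀ s₀ hadj
  have hun : ∀ u, fmin (fun s : Y u => repUnary G Y θv ψ u s) ≤
      -fmin (fun s => -θv u s) - if u = u₀ then ψ u₀ v₀ s₀ else 0 := by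
    intro u
    have hterm : ∀ s : Y u, ∀ v ∈ Finset.univ, 0 ≤ if G.Adj u v then ψ u v s else 0 := by
      intro s v _
      split_ifs
      · exact hnn u v s
      · exact le_rfl
    by_cases hu : u = u₀
    · subst hu
      have h1 := fmin_le (fun s : Y u => repUnary G Y θv ψ u s) s₀
      have h2 := fmin_le (fun s => -θv u s) s₀
      have h3 := Finset.single_le_sum (hterm s₀) (Finset.mem_univ v₀)
      simp only [hadj, if_true] at h3
      simp only [repUnary, if_true] at *
      linarith
    · obtain ⟨s⟩ := (inferInstance : Nonempty (Y u))
      have h1 := fmin_le (fun s : Y u => repUnary G Y θv ψ u s) s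
      have h2 := fmin_le (fun s => -θv u s) s
      have h3 := Finset.sum_nonneg (hterm s)
      simp only [repUnary, hu, if_false] at *
      linarith
  have hsum := Finset.sum_le_sum fun u (_ : u ∈ Finset.univ) => hun u
  rw [Finset.sum_sub_distrib, Finset.sum_ite_eq' Finset.univ u₀] at hsum
  simp only [Finset.mem_univ, if_true] at hsum
  have hpair : (∑ u, ∑ v, if G.Adj u v then
        fmin (fun p : Y u × Y v => repPair Y θe ψ u v p.1 p.2) else 0) ≤
      ∑ u, ∑ v, if G.Adj u v then -fmin (fun p : Y u × Y v => -θe u v p.1 p.2) else 0 := by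
    refine Finset.sum_le_sum fun u _ => Finset.sum_le_sum fun v _ => ?_
    split_ifs
    · obtain ⟨s, hs⟩ := hz u v
      obtain ⟨t, ht⟩ := hz v u
      have h1 := fmin_le (fun p : Y u × Y v => repPair Y θe ψ u v p.1 p.2) (s, t)
      have h2 := fmin_le (fun p : Y u × Y v => -θe u v p.1 p.2) (s, t)
      simp only [repPair, hs, ht] at *
      linarith
    · exact le_rfl
  unfold dualD
  linarith

/-- The Lagrange dual attains its supremum. -/
theorem exists_forall_dualD_le : ∃ φ : ∀ (u v : V), Y u → ℝ,
    ∀ φ' : ∀ (u v : V), Y u → ℝ, dualD G Y θv θe φ' ≤ dualD G Y θv θe φ := by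
  obtain ⟨B, hB⟩ := exists_dualD_le_sub G Y θv θe
  set R : ℝ := max 0 (B - dualD G Y θv θe 0)
  have h0R : (0 : ∀ (u v : V), Y u → ℝ) ≤ fun _ _ _ => R := fun _ _ _ => le_max_left _ _
  obtain ⟨φ, -, hφ⟩ := (isCompact_Icc (a := (0 : ∀ (u v : V), Y u → ℝ))
    (b := fun _ _ _ => R)).exists_isMaxOn ⟨0, le_rfl, h0R⟩
    (continuous_dualD G Y θv θe).continuousOn
  refine ⟨φ, fun φ' => ?_⟩
  rw [← dualD_sub_const G Y θv θe φ' fun u v => fmin (φ' u v)]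
  set ψ : ∀ (u v : V), Y u → ℝ :=
    fun u v s => if G.Adj u v then φ' u v s - fmin (φ' u v) else 0 with hψ
  have hnn : ∀ u v s, 0 ≤ ψ u v s := by
    intro u v s
    simp only [hψ]
    split_ifs
    · linarith [fmin_le (φ' u v) s]
    · exact le_rfl
  have hz : ∀ u v, ∃ s, ψ u v s = 0 := by
    intro u v
    obtain ⟨s, hs⟩ := exists_eq_fmin (φ' u v)
    exact ⟨s, by simp [hψ, hs]⟩
  by_cases hR : ∀ u v s, ψ u v s ≤ R
  · exact hφ (a := ψ) ⟨hnn, hR⟩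
  · push Not at hR
    obtain ⟨u, v, s, hs⟩ := hR
    have hadj : G.Adj u v := by
      by_contra h
      simp only [hψ, h, if_false] at hs
      exact absurd hs (not_lt.mpr (le_max_left _ _))
    have h1 := hB ψ hnn hz u v s hadj
    have h2 : B - dualD G Y θv θe 0 ≤ R := le_max_right _ _
    have h3 : dualD G Y θv θe 0 ≤ dualD G Y θv θe φ := hφ (a := 0) ⟨le_rfl, h0R⟩
    linarith

/-- Moving all unary costs into incident edges does not decrease the dual. -/
theorem exists_dualD_le_and_repUnary_eq_zero (hdeg : ∀ u : V, ∃ v, G.Adj u v)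
    (φ : ∀ (u v : V), Y u → ℝ) : ∃ ψ : ∀ (u v : V), Y u → ℝ,
      dualD G Y θv θe φ ≤ dualD G Y θv θe ψ ∧ ∀ u s, repUnary G Y θv ψ u s = 0 := by
  classical
  choose n hn using hdeg
  set ψ : ∀ (u v : V), Y u → ℝ :=
    fun u v s => φ u v s + if v = n u then repUnary G Y θv φ u s else 0 with hψ
  have hzero : ∀ u s, repUnary G Y θv ψ u s = 0 := by
    intro u s
    have h : (∑ v, if G.Adj u v then ψ u v s else 0) =
        (∑ v, if G.Adj u v then φ u v s else 0) +
          ∑ v, if v = n u then repUnary G Y θv φ u s else 0 := by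
      rw [← Finset.sum_add_distrib]
      refine Finset.sum_congr rfl fun v _ => ?_
      by_cases hv : v = n u
      · subst hv
        simp [hψ, hn]
      · simp [hψ, hv]
    rw [Finset.sum_ite_eq' Finset.univ (n u)] at h
    simp only [Finset.mem_univ, if_true] at h
    rw [repUnary, h, repUnary]
    ring
  refine ⟨ψ, ?_, hzero⟩
  set c : V → V → ℝ :=
    fun u v => if v = n u then fmin (fun s : Y u => repUnary G Y θv φ u s) else 0 with hc
  have hcsum : (∑ u, ∑ v, if G.Adj u v then c u v else 0) =
      ∑ u, fmin (fun s : Y u => repUnary G Y θv φ u s) := by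
    refine Finset.sum_congr rfl fun u _ => ?_
    rw [Finset.sum_eq_single (n u)]
    · simp [hc, hn]
    · intro v _ hv
      simp [hc, hv]
    · simp
  have hcle : ∀ u v s, φ u v s + c u v ≤ ψ u v s := by
    intro u v s
    simp only [hψ, hc]
    split_ifs
    · linarith [fmin_le (fun s : Y u => repUnary G Y θv φ u s) s]
    · exact le_rfl
  have hpair : (∑ u, ∑ v, if G.Adj u v then
        fmin (fun p : Y u × Y v => repPair Y θe φ u v p.1 p.2) else 0) +
      (∑ u, ∑ v, if G.Adj u v then c u v + c v u else 0) ≤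
      ∑ u, ∑ v, if G.Adj u v then
        fmin (fun p : Y u × Y v => repPair Y θe ψ u v p.1 p.2) else 0 := by
    simp only [← Finset.sum_add_distrib]
    refine Finset.sum_le_sum fun u _ => Finset.sum_le_sum fun v _ => ?_
    split_ifs
    · refine le_fmin fun p => ?_
      have h1 := fmin_le (fun p : Y u × Y v => repPair Y θe φ u v p.1 p.2) p
      have h2 := hcle u v p.1
      have h3 := hcle v u p.2
      simp only [repPair] at *
      linarith
    · simp
  have hun : (0 : ℝ) ≤ ∑ u, fmin (fun s : Y u => repUnary G Y θv ψ u s) :=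
    Finset.sum_nonneg fun u _ => le_fmin fun s => (hzero u s).ge
  have hswap := half_sum_adj_add_swap G c
  unfold dualD
  linarith

end Dual

/-- **If every node has at least one incident edge, then there is a dual
optimal reparametrization with vanishing reparametrized unary costs**:
some `φ` maximizes `D` and satisfies `θ^φ_u(s) = 0` for every node `u` and
label `s`. -/
theorem statement_10 (G : SimpleGraph V) [DecidableRel G.Adj]
    (Y : V → Type) [∀ u, Fintype (Y u)] [∀ u, Nonempty (Y u)]
    (θv : ∀ u, Y u → ℝ) (θe : ∀ u v, Y u → Y v → ℝ)
    (hθsym : ∀ u v s t, θe u v s t = θe v u t s)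
    (hdeg : ∀ u : V, ∃ v, G.Adj u v) :
    ∃ φ : ∀ (u v : V), Y u → ℝ,
      (∀ φ' : ∀ (u v : V), Y u → ℝ, dualD G Y θv θe φ' ≤ dualD G Y θv θe φ) ∧
      ∀ (u : V) (s : Y u), repUnary G Y θv φ u s = 0 := by
  obtain ⟨φ, hφ⟩ := exists_forall_dualD_le G Y θv θe
  obtain ⟨ψ, hle, hzero⟩ := exists_dualD_le_and_repUnary_eq_zero G Y θv θe hdeg φ
  exact ⟨ψ, fun φ' => (hφ φ').trans hle, hzero⟩
end

section
/- Let each label set Y_u of a pairwise graphical model be a nonempty finite linearly ordered set, and define on labelings the componentwise operations (y ∨ y')_u = max(y_u, y'_u) and (y ∧ y')_u = min(y_u, y'_u). Then the energy E(·;θ) is submodular, i.e. E(y;θ) + E(y';θ) ≥ E(y ∧ y';θ) + E(y ∨ y';θ) for all labelings y, y', if and only if every pairwise cost function θ_{uv}, uv ∈ E, is submodular, i.e. θ_{uv}(s₁,l₁) + θ_{uv}(s₂,l₂) ≤ θ_{uv}(s₂,l₁) + θ_{uv}(s₁,l₂) for all s₁ ≤ s₂ in Y_u and l₁ ≤ l₂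 in Y_v. -/
open Finset

variable {V : Type} [Fintype V] [DecidableEq V]

/-- The energy `E(y;θ) = Σ_u θ_u(y_u) + Σ_{uv∈E} θ_{uv}(y_u,y_v)` of a labeling
(each unordered edge counted once via the halved sum over ordered pairs). -/
noncomputable def energy (G : SimpleGraph V) [DecidableRel G.Adj]
    (Y : V → Type) (θv : ∀ u, Y u → ℝ) (θe : ∀ u v, Y u → Y v → ℝ)
    (y : ∀ u, Y u) : ℝ :=
  (∑ u, θv u (y u)) +
    (∑ u, ∑ v, if G.Adj u v then θe u v (y u) (y v) else 0) / 2

/-- The excess `f(s,l) + f(s',l') - f(s ∧ s', l ∧ l') - f(s ∨ s', l ∨ l')` of a pairwise cost. -/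
def submodularExcess {A B : Type} [LinearOrder A] [LinearOrder B] (f : A → B → ℝ)
    (s s' : A) (l l' : B) : ℝ :=
  f s l + f s' l' - f (min s s') (min l l') - f (max s s') (max l l')

theorem submodularExcess_swap {A B : Type} [LinearOrder A] [LinearOrder B] {f : A → B → ℝ}
    {g : B → A → ℝ} (h : ∀ s l, f s l = g l s) (s s' : A) (l l' : B) :
    submodularExcess f s s' l l' = submodularExcess g l l' s s' := by
  simp only [submodularExcess, h]

theorem submodularExcess_self_left {A B : Type} [LinearOrder A] [LinearOrder B]
    (f : A → B → ℝ) (s : A) (l l' : B) : submodularExcess f s s l l' = 0 := by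
  rcases le_total l l' with h | h <;> simp [submodularExcess, h]

theorem submodularExcess_self_right {A B : Type} [LinearOrder A] [LinearOrder B]
    (f : A → B → ℝ) (s s' : A) (l : B) : submodularExcess f s s' l l = 0 := by
  rcases le_total s s' with h | h <;> simp [submodularExcess, h]

theorem submodularExcess_nonneg {A B : Type} [LinearOrder A] [LinearOrder B] {f : A → B → ℝ}
    (hf : ∀ s₁ s₂ l₁ l₂, s₁ ≤ s₂ → l₁ ≤ l₂ → f s₁ l₁ + f s₂ l₂ ≤ f s₂ l₁ + f s₁ l₂)
    (s s' : A) (l l' : B) : 0 ≤ submodularExcess f s s' l l' := by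
  rcases le_total s s' with h | h <;> rcases le_total l l' with k | k <;>
    simp only [submodularExcess, min_eq_left, min_eq_right, max_eq_left, max_eq_right, h, k] <;>
    linarith [hf _ _ _ _ h k]

theorem energy_add_energy_sub (G : SimpleGraph V) [DecidableRel G.Adj]
    (Y : V → Type) [∀ u, LinearOrder (Y u)]
    (θv : ∀ u, Y u → ℝ) (θe : ∀ u v, Y u → Y v → ℝ) (y y' : ∀ u, Y u) :
    energy G Y θv θe y + energy G Y θv θe y' -
        (energy G Y θv θe (fun u => min (y u) (y' u)) +
          energy G Y θv θe (fun u => max (y u) (y' u))) =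
      (∑ u, ∑ v, if G.Adj u v then
        submodularExcess (θe u v) (y u) (y' u) (y v) (y' v) else 0) / 2 := by
  have unary : ∑ u, θv u (y u) + ∑ u, θv u (y' u) =
      ∑ u, θv u (min (y u) (y' u)) + ∑ u, θv u (max (y u) (y' u)) := by
    rw [← sum_add_distrib, ← sum_add_distrib]
    refine sum_congr rfl fun u _ => ?_
    rcases le_total (y u) (y' u) with h | h <;> simp [h, add_comm]
  have pairwise : (∑ u, ∑ v, if G.Adj u v then
        submodularExcess (θe u v) (y u) (y' u) (y v) (y' v) else 0) =
      (∑ u, ∑ v, if G.Adj u v then θe u v (y u) (y v) else 0) +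
      (∑ u, ∑ v, if G.Adj u v then θe u v (y' u) (y' v) else 0) -
      (∑ u, ∑ v, if G.Adj u v then θe u v (min (y u) (y' u)) (min (y v) (y' v)) else 0) -
      (∑ u, ∑ v, if G.Adj u v then θe u v (max (y u) (y' u)) (max (y v) (y' v)) else 0) := by
    simp only [← sum_add_distrib, ← sum_sub_distrib]
    refine sum_congr rfl fun u _ => sum_congr rfl fun v _ => ?_
    split_ifs <;> simp [submodularExcess]
  rw [pairwise]
  simp only [energy]
  linarith

/-- **The energy of a pairwise graphical model with linearly ordered label sets
is submodular (w.r.t. the componentwise lattice operations on labelings) if and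
only if every pairwise cost function is submodular.** -/
theorem statement_11 (G : SimpleGraph V) [DecidableRel G.Adj]
    (Y : V → Type) [∀ u, LinearOrder (Y u)] [∀ u, Fintype (Y u)] [∀ u, Nonempty (Y u)]
    (θv : ∀ u, Y u → ℝ) (θe : ∀ u v, Y u → Y v → ℝ)
    (hθsym : ∀ u v s t, θe u v s t = θe v u t s) :
    (∀ y y' : ∀ u, Y u,
        energy G Y θv θe (fun u => min (y u) (y' u)) +
          energy G Y θv θe (fun u => max (y u) (y' u)) ≤
        energy G Y θv θe y + energy G Y θv θe y') ↔
    (∀ u v, G.Adj u v → ∀ s₁ s₂ : Y u, ∀ l₁ l₂ : Y v, s₁ ≤ s₂ → l₁ ≤ l₂ →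
        θe u v s₁ l₁ + θe u v s₂ l₂ ≤ θe u v s₂ l₁ + θe u v s₁ l₂) := by
  have key (y y' : ∀ u, Y u) := energy_add_energy_sub G Y θv θe y y'
  constructor
  · intro hE u v huv s₁ s₂ l₁ l₂ hs hl
    by_contra! hlt
    let z : ∀ w, Y w := fun w => Classical.arbitrary (Y w)
    let y : ∀ w, Y w := Function.update (Function.update z u s₂) v l₁
    let y' : ∀ w, Y w := Function.update (Function.update z u s₁) v l₂
    have hyu : y u = s₂ := by simp [y, huv.ne]
    have hyu' : y' u = s₁ := by simp [y', huv.ne]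
    have hyv : y v = l₁ := by simp [y]
    have hyv' : y' v = l₂ := by simp [y']
    have agree (w : V) (hu : w ≠ u) (hv : w ≠ v) : y w = y' w := by simp [y, y', hu, hv]
    have neg_uv : submodularExcess (θe u v) (y u) (y' u) (y v) (y' v) < 0 := by
      rw [hyu, hyu', hyv, hyv']
      simp only [submodularExcess, min_eq_left hl, min_eq_right hs, max_eq_right hl,
        max_eq_left hs]
      linarith
    have neg_vu : submodularExcess (θe v u) (y v) (y' v) (y u) (y' u) < 0 :=
      submodularExcess_swap (hθsym u v) _ _ _ _ ▸ neg_uv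
    have nonpos (a b : V) : (if G.Adj a b then
        submodularExcess (θe a b) (y a) (y' a) (y b) (y' b) else 0) ≤ 0 := by
      split_ifs with hab
      · by_cases ha : y a = y' a
        · rw [ha, submodularExcess_self_left]
        by_cases hb : y b = y' b
        · rw [hb, submodularExcess_self_right]
        have ha' : a = u ∨ a = v := by
          by_contra! h
          exact ha (agree a h.1 h.2)
        have hb' : b = u ∨ b = v := by
          by_contra! h
          exact hb (agree b h.1 h.2)
        rcases ha' with rfl | rfl <;> rcases hb' with rfl | rfl
        · exact absurd rfl hab.ne
        · exact neg_uv.le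
        · exact neg_vu.le
        · exact absurd rfl hab.ne
      · exact le_rfl
    have sum_neg : (∑ a, ∑ b, if G.Adj a b then
        submodularExcess (θe a b) (y a) (y' a) (y b) (y' b) else 0) < 0 := by
      refine sum_neg' (fun a _ => sum_nonpos fun b _ => nonpos a b) ⟨u, mem_univ u, ?_⟩
      refine sum_neg' (fun b _ => nonpos u b) ⟨v, mem_univ v, ?_⟩
      rwa [if_pos huv]
    linarith [hE y y', key y y']
  · intro hθ y y'
    have sum_nonneg : 0 ≤ ∑ a, ∑ b, if G.Adj a b then
        submodularExcess (θe a b) (y a) (y' a) (y b) (y' b) else 0 := by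
      refine sum_nonneg fun a _ => sum_nonneg fun b _ => ?_
      split_ifs with hab
      · exact submodularExcess_nonneg (hθ a b hab) _ _ _ _
      · exact le_rfl
    linarith [key y y']
end

section
/- Let each label set Y_u be a nonempty finite linearly ordered set and assume every pairwise cost θ_{uv}, uv ∈ E, is submodular. Let ξ be an arc-consistent 0/1 vector such that for every node u there exists s with ξ_u(s) = 1, and such that every 1-coordinate of ξ is locally minimal: ξ_u(s) = 1 implies θ_u(s) = min_{s'∈Y_u} θ_u(s'), and ξ_{uv}(s,t) = 1 implies θ_{uv}(s,t) = min_{(s',t')∈Y_u×Y_v} θ_{uv}(s',t'). Define the labeling y by y_u = max{s ∈ Y_u : ξ_u(s) = 1} for every node u. Then y consists of locally optimal labels and label pairs: θ_u(y_u) = min_{s∈Y_u} θ_u(s) for every u ∈ V and θ_{uv}(y_u, y_v) = min_{(s,t)∈Y_u×Y_v} θ_{uv}(s,t) for every edge uv ∈ E. -/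
variable {V : Type} [Fintype V] [DecidableEq V]

/-- **For submodular pairwise costs, picking in each node the highest label of
an arc-consistent collection of locally minimal labels yields a labeling
consisting of locally optimal labels and label pairs.**
Here `ξv u s` means `ξ_u(s) = 1` and `ξe u v s t` means `ξ_{uv}(s,t) = 1`. -/
theorem statement_14 (G : SimpleGraph V)
    (Y : V → Type) [∀ u, LinearOrder (Y u)] [∀ u, Fintype (Y u)] [∀ u, Nonempty (Y u)]
    (θv : ∀ u, Y u → ℝ) (θe : ∀ u v, Y u → Y v → ℝ)
    (hθsym : ∀ u v s t, θe u v s t = θe v u t s)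
    (hsub : ∀ u v, G.Adj u v → ∀ s₁ s₂ : Y u, ∀ l₁ l₂ : Y v, s₁ ≤ s₂ → l₁ ≤ l₂ →
        θe u v s₁ l₁ + θe u v s₂ l₂ ≤ θe u v s₂ l₁ + θe u v s₁ l₂)
    (ξv : ∀ u, Y u → Prop) (ξe : ∀ u v, Y u → Y v → Prop)
    (hξsym : ∀ u v s t, ξe u v s t ↔ ξe v u t s)
    (hac1 : ∀ u v, G.Adj u v → ∀ s t, ξe u v s t → ξv u s ∧ ξv v t)
    (hac2 : ∀ u v, G.Adj u v → ∀ s, ξv u s → ∃ t, ξe u v s t)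
    (hcover : ∀ u, ∃ s, ξv u s)
    (hlocv : ∀ u s, ξv u s → ∀ s', θv u s ≤ θv u s')
    (hloce : ∀ u v, G.Adj u v → ∀ s t, ξe u v s t → ∀ s' t', θe u v s t ≤ θe u v s' t')
    (y : ∀ u, Y u)
    (hy : ∀ u, ξv u (y u) ∧ ∀ s, ξv u s → s ≤ y u) :
    (∀ (u : V) (s' : Y u), θv u (y u) ≤ θv u s') ∧
    (∀ u v, G.Adj u v → ∀ (s : Y u) (t : Y v), θe u v (y u) (y v) ≤ θe u v s t) := by
  refine ⟨fun u => hlocv u _ (hy u).1, fun u v huv s' t' => ?_⟩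
  obtain ⟨t, ht⟩ := hac2 u v huv _ (hy u).1
  obtain ⟨s, hs⟩ := hac2 v u huv.symm _ (hy v).1
  rw [hξsym] at hs
  have hsy := (hy u).2 s (hac1 u v huv _ _ hs).1
  have hty := (hy v).2 t (hac1 u v huv _ _ ht).2
  linarith [hsub u v huv _ _ _ _ hsy hty, hloce u v huv _ _ ht s t, hloce u v huv _ _ hs s' t']
end

section
/- Let a pairwise graphical model have a common finite label set Y₀ with |Y₀| ≥ 2 for all nodes, nonnegative unary costs θ_u ≥ 0, a nonempty edge set, and suppose every pairwise cost θ_{uv} is a metric on Y₀ (θ_{uv}(s,t) ≥ 0 with equality iff s = t, θ_{uv}(s,t) = θ_{uv}(t,s), and θ_{uv}(s,t) + θ_{uv}(t,r) ≥ θ_{uv}(s,r) for all s,t,r ∈ Y₀). Set c := max_{uv∈E} (max_{s≠t} θ_{uv}(s,t)) / (min_{s≠t} θ_{uv}(s,t)). Let y' be a labeling that is a local minimum with respect to expansion moves, i.e. for every label α ∈ Y₀, E(y';θ) ≤ E(y;θ) for every labeling y with y_u ∈ {y'_u, α} for all u ∈ V, and let y* be a labeling minimizing E(·;θ). Then E(y';θ)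 ≤ 2c · E(y*;θ). -/
open Finset

variable {V : Type} [Fintype V] [DecidableEq V]

/-- The energy `E(y;θ) = Σ_u θ_u(y_u) + Σ_{uv∈E} θ_{uv}(y_u,y_v)` of a labeling
for a model with a common label set `Y` (each unordered edge counted once via
the halved sum over ordered pairs). -/
noncomputable def energyC (G : SimpleGraph V) [DecidableRel G.Adj]
    (Y : Type) (θv : V → Y → ℝ) (θe : V → V → Y → Y → ℝ) (y : V → Y) : ℝ :=
  (∑ u, θv u (y u)) +
    (∑ u, ∑ v, if G.Adj u v then θe u v (y u) (y v) else 0) / 2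

open Classical in
/-- The expansion move towards `ystar` with label `α` changes the energy of `y'` by at most the
sum of the changes charged to the nodes and edges that `ystar` labels with `α`. -/
lemma energyC_expansion_le (G : SimpleGraph V) [DecidableRel G.Adj]
    (Y : Type) (θv : V → Y → ℝ) (θe : V → V → Y → Y → ℝ)
    (hmet0 : ∀ u v, G.Adj u v → ∀ s t, 0 ≤ θe u v s t)
    (hmet1 : ∀ u v, G.Adj u v → ∀ s t, θe u v s t = 0 ↔ s = t)
    (c : ℝ) (y' ystar : V → Y)
    (hbound : ∀ u v, G.Adj u v → ∀ s t s' t', s' ≠ t' → θe u v s t ≤ c * θe u v s' t')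
    (α : Y) :
    energyC G Y θv θe (fun u => if ystar u = α then α else y' u) ≤
      energyC G Y θv θe y' +
        ((∑ u, if ystar u = α then θv u (ystar u) - θv u (y' u) else 0) +
          (∑ u, ∑ v, if G.Adj u v then
            (if ystar u = α then c * θe u v (ystar u) (ystar v) - θe u v (y' u) (y' v) / 2
              else 0) +
            (if ystar v = α then c * θe u v (ystar u) (ystar v) - θe u v (y' u) (y' v) / 2
              else 0) else 0) / 2) := by
  have hunary : ∀ u, θv u (if ystar u = α then α else y' u) ≤
      θv u (y' u) + if ystar u = α then θv u (ystar u) - θv u (y' u) else 0 := by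
    intro u
    split_ifs with h
    · rw [h]; linarith
    · linarith
  have hpair : ∀ u v, (if G.Adj u v then θe u v (if ystar u = α then α else y' u)
        (if ystar v = α then α else y' v) else 0) ≤
      (if G.Adj u v then θe u v (y' u) (y' v) else 0) + if G.Adj u v then
        (if ystar u = α then c * θe u v (ystar u) (ystar v) - θe u v (y' u) (y' v) / 2 else 0) +
        (if ystar v = α then c * θe u v (ystar u) (ystar v) - θe u v (y' u) (y' v) / 2 else 0)
        else 0 := by
    intro u v
    by_cases ha : G.Adj u v
    · simp only [ha, if_true]
      have h0 := hmet0 u v ha (y' u) (y' v)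
      have hself := (hmet1 u v ha α α).2 rfl
      by_cases hu : ystar u = α <;> by_cases hv : ystar v = α
      · simp only [hu, hv, if_true, hself]
        linarith
      · have hb := hbound u v ha α (y' v) (ystar u) (ystar v) (fun h => hv (h ▸ hu))
        simp only [if_pos hu, if_neg hv]
        linarith
      · have hb := hbound u v ha (y' u) α (ystar u) (ystar v) (fun h => hu (h ▸ hv))
        simp only [if_neg hu, if_pos hv]
        linarith
      · simp [hu, hv]
    · simp [ha]
  have h1 := Finset.sum_le_sum fun u (_ : u ∈ univ) => hunary u
  have h2 := Finset.sum_le_sum fun u (_ : u ∈ univ) =>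
    Finset.sum_le_sum fun v (_ : v ∈ univ) => hpair u v
  simp only [Finset.sum_add_distrib] at h1 h2
  unfold energyC
  linarith

/-- **Multiplicative optimality bound for the α-expansion algorithm
(Boykov–Veksler–Zabih).**  For a model with a common label set, nonnegative
unary costs and metric pairwise costs, let
`c = max_{uv∈E} (max_{s≠t} θ_{uv}(s,t)) / (min_{s≠t} θ_{uv}(s,t))`
(characterized below as the greatest ratio `θ_{uv}(s,t)/θ_{uv}(s',t')` over
edges and pairs of distinct labels).  If `y'` is a local minimum w.r.t.
expansion moves and `y*` a global minimizer of the energy, then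
`E(y';θ) ≤ 2c·E(y*;θ)`. -/
theorem statement_15 (G : SimpleGraph V) [DecidableRel G.Adj]
    (Y : Type) [Fintype Y] [Nonempty Y] (hY : 2 ≤ Fintype.card Y)
    (θv : V → Y → ℝ) (θe : V → V → Y → Y → ℝ)
    (hθsym : ∀ u v s t, θe u v s t = θe v u t s)
    (hθv0 : ∀ u s, 0 ≤ θv u s)
    (hE : ∃ u v, G.Adj u v)
    (hmet0 : ∀ u v, G.Adj u v → ∀ s t, 0 ≤ θe u v s t)
    (hmet1 : ∀ u v, G.Adj u v → ∀ s t, θe u v s t = 0 ↔ s = t)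
    (hmet2 : ∀ u v, G.Adj u v → ∀ s t, θe u v s t = θe u v t s)
    (hmet3 : ∀ u v, G.Adj u v → ∀ s t r, θe u v s r ≤ θe u v s t + θe u v t r)
    (c : ℝ)
    (hc : IsGreatest {r : ℝ | ∃ u v, G.Adj u v ∧ ∃ s t s' t' : Y,
        s ≠ t ∧ s' ≠ t' ∧ r = θe u v s t / θe u v s' t'} c)
    (y' : V → Y)
    (hloc : ∀ α : Y, ∀ y : V → Y, (∀ u, y u = y' u ∨ y u = α) →
        energyC G Y θv θe y' ≤ energyC G Y θv θe y)
    (ystar : V → Y)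
    (hopt : ∀ y : V → Y, energyC G Y θv θe ystar ≤ energyC G Y θv θe y) :
    energyC G Y θv θe y' ≤ 2 * c * energyC G Y θv θe ystar := by
  classical
  have hpos : ∀ u v, G.Adj u v → ∀ s t, s ≠ t → 0 < θe u v s t := fun u v ha s t hst =>
    lt_of_le_of_ne (hmet0 u v ha s t) fun h => hst ((hmet1 u v ha s t).1 h.symm)
  have hc1 : 1 ≤ c := by
    obtain ⟨u, v, ha⟩ := hE
    obtain ⟨s, t, hst⟩ := Fintype.exists_pair_of_one_lt_card (by omega : 1 < Fintype.card Y)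
    exact hc.2 ⟨u, v, ha, s, t, s, t, hst, hst, (div_self (hpos u v ha s t hst).ne').symm⟩
  have hbound : ∀ u v, G.Adj u v → ∀ s t s' t', s' ≠ t' →
      θe u v s t ≤ c * θe u v s' t' := by
    intro u v ha s t s' t' hne
    have hp := hpos u v ha s' t' hne
    by_cases hst : s = t
    · rw [(hmet1 u v ha s t).2 hst]
      positivity
    · exact (div_le_iff₀ hp).1 (hc.2 ⟨u, v, ha, s, t, s', t', hst, hne, rfl⟩)
  have hmove : ∀ α, 0 ≤ (∑ u, if ystar u = α then θv u (ystar u) - θv u (y' u) else 0) +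
      (∑ u, ∑ v, if G.Adj u v then
        (if ystar u = α then c * θe u v (ystar u) (ystar v) - θe u v (y' u) (y' v) / 2 else 0) +
        (if ystar v = α then c * θe u v (ystar u) (ystar v) - θe u v (y' u) (y' v) / 2 else 0)
        else 0) / 2 := by
    intro α
    have h1 := hloc α (fun u => if ystar u = α then α else y' u) fun u => by
      by_cases h : ystar u = α <;> simp [h]
    have h2 := energyC_expansion_le G Y θv θe hmet0 hmet1 c y' ystar hbound α
    linarith
  have hsum := Finset.sum_nonneg fun α (_ : α ∈ univ) => hmove α
  have hunary : (∑ α, ∑ u, if ystar u = α then θv u (ystar u) - θv u (y' u) else 0) =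
      ∑ u, θv u (ystar u) - ∑ u, θv u (y' u) := by
    rw [Finset.sum_comm]
    simp
  have hpair : (∑ α, ∑ u, ∑ v, if G.Adj u v then
        (if ystar u = α then c * θe u v (ystar u) (ystar v) - θe u v (y' u) (y' v) / 2 else 0) +
        (if ystar v = α then c * θe u v (ystar u) (ystar v) - θe u v (y' u) (y' v) / 2 else 0)
        else 0) =
      2 * c * (∑ u, ∑ v, if G.Adj u v then θe u v (ystar u) (ystar v) else 0) -
        ∑ u, ∑ v, if G.Adj u v then θe u v (y' u) (y' v) else 0 := by
    rw [Finset.sum_comm, Finset.mul_sum, ← Finset.sum_sub_distrib]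
    refine Finset.sum_congr rfl fun u _ => ?_
    rw [Finset.sum_comm, Finset.mul_sum, ← Finset.sum_sub_distrib]
    refine Finset.sum_congr rfl fun v _ => ?_
    by_cases ha : G.Adj u v
    · simp only [ha, if_true, Finset.sum_add_distrib, Finset.sum_ite_eq, Finset.mem_univ]
      ring
    · simp [ha]
  rw [Finset.sum_add_distrib, ← Finset.sum_div, hunary, hpair] at hsum
  have hθ : 0 ≤ ∑ u, θv u (ystar u) := Finset.sum_nonneg fun u _ => hθv0 u _
  unfold energyC
  nlinarith [mul_nonneg (sub_nonneg.2 hc1) hθ]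
end

section
/- Let a pairwise graphical model be binary, i.e. Y_u = {0,1} for every node u. Let ξ be an arc-consistent 0/1 vector such that for every node u there exists s with ξ_u(s) = 1. Then there exists a vector μ in the local polytope L all of whose coordinates lie in {0, 1/2, 1} and whose support is contained in that of ξ: μ_u(s) > 0 implies ξ_u(s) = 1 for every node u and label s, and μ_{uv}(s,t) > 0 implies ξ_{uv}(s,t) = 1 for every edge uv and label pair (s,t). -/
open Finset

variable {V : Type} [Fintype V] [DecidableEq V]

open Classical in
/-- The uniform distribution on the labels satisfying `p`. -/
noncomputable def halfUnary (p : Bool → Prop) (s : Bool) : ℝ :=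
  if p s then (if p !s then 1 / 2 else 1) else 0

open Classical in
/-- A half-integral coupling of `halfUnary p` and `halfUnary q` supported in `R`: when both
nodes keep both labels it is uniform on the diagonal or on the antidiagonal, and otherwise it
is the product. -/
noncomputable def halfCoupling (p q : Bool → Prop) (R : Bool → Bool → Prop) (s t : Bool) : ℝ :=
  if p false ∧ p true ∧ q false ∧ q true then
    if R false false ∧ R true true then (if s = t then 1 / 2 else 0)
    else (if s = t then 0 else 1 / 2)
  else halfUnary p s * halfUnary q t

section HalfIntegral

variable {p q : Bool → Prop} {R : Bool → Bool → Prop}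

theorem halfUnary_mem (p : Bool → Prop) (s : Bool) :
    halfUnary p s = 0 ∨ halfUnary p s = 1 / 2 ∨ halfUnary p s = 1 := by
  unfold halfUnary
  split_ifs <;> simp

theorem halfUnary_nonneg (p : Bool → Prop) (s : Bool) : 0 ≤ halfUnary p s := by
  rcases halfUnary_mem p s with h | h | h <;> rw [h] <;> norm_num

theorem of_halfUnary_pos {s : Bool} (h : 0 < halfUnary p s) : p s := by
  by_contra hs
  simp [halfUnary, hs] at h

theorem sum_halfUnary (hp : ∃ s, p s) : ∑ s, halfUnary p s = 1 := by
  rw [Bool.exists_bool] at hp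
  by_cases h₀ : p false <;> by_cases h₁ : p true <;> simp_all [halfUnary]; norm_num

theorem halfCoupling_comm (p q : Bool → Prop) (R : Bool → Bool → Prop) (s t : Bool) :
    halfCoupling p q R s t = halfCoupling q p (fun a b => R b a) t s := by
  unfold halfCoupling
  rw [mul_comm]
  congr 1
  · exact propext (by tauto)
  · simp only [eq_comm]

theorem halfCoupling_mem (p q : Bool → Prop) (R : Bool → Bool → Prop) (s t : Bool) :
    halfCoupling p q R s t = 0 ∨ halfCoupling p q R s t = 1 / 2 ∨
      halfCoupling p q R s t = 1 := by
  unfold halfCoupling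
  by_cases h : p false ∧ p true ∧ q false ∧ q true
  · rw [if_pos h]
    split_ifs <;> simp
  · rw [if_neg h]
    by_cases h₀ : p false <;> by_cases h₁ : p true <;> by_cases h₂ : q false <;>
      by_cases h₃ : q true <;> cases s <;> cases t <;> simp_all [halfUnary]

theorem halfCoupling_nonneg (p q : Bool → Prop) (R : Bool → Bool → Prop) (s t : Bool) :
    0 ≤ halfCoupling p q R s t := by
  rcases halfCoupling_mem p q R s t with h | h | h <;> rw [h] <;> norm_num

theorem sum_halfCoupling_right (hq : ∃ t, q t) (s : Bool) :
    ∑ t, halfCoupling p q R s t = halfUnary p s := by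
  by_cases h : p false ∧ p true ∧ q false ∧ q true
  · obtain ⟨h₀, h₁, h₂, h₃⟩ := h
    by_cases hR : R false false ∧ R true true <;> cases s <;>
      simp [halfCoupling, halfUnary, h₀, h₁, h₂, h₃, hR]
  · simp only [halfCoupling, if_neg h, ← Finset.mul_sum, sum_halfUnary hq, mul_one]

theorem sum_halfCoupling_left (hp : ∃ s, p s) (t : Bool) :
    ∑ s, halfCoupling p q R s t = halfUnary q t := by
  simp only [halfCoupling_comm p q R]
  exact sum_halfCoupling_right hp t

theorem of_halfCoupling_pos (hR : ∀ s t, R s t → p s ∧ q t) (hp : ∀ s, p s → ∃ t, R s t)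
    (hq : ∀ t, q t → ∃ s, R s t) {s t : Bool} (h : 0 < halfCoupling p q R s t) : R s t := by
  simp only [Bool.forall_bool, Bool.exists_bool] at hR hp hq
  by_cases hpq : p false ∧ p true ∧ q false ∧ q true
  · rw [halfCoupling, if_pos hpq] at h
    cases s <;> cases t <;> grind
  · rw [halfCoupling, if_neg hpq] at h
    have hs : p s := of_halfUnary_pos (pos_of_mul_pos_left h (halfUnary_nonneg q t))
    have ht : q t := of_halfUnary_pos (pos_of_mul_pos_right h (halfUnary_nonneg p s))
    cases s <;> cases t <;> grind

end HalfIntegral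

/-- **Half-integrality for binary models (labels `Bool`): every arc-consistent
0/1 vector with nonempty node supports dominates a half-integral point of the
local polytope.**  Here `ξv u s` means `ξ_u(s) = 1` and `ξe u v s t` means
`ξ_{uv}(s,t) = 1`; the produced `μ ∈ L` has all coordinates in `{0, 1/2, 1}`
and its support is contained in that of `ξ`. -/
theorem statement_16 (G : SimpleGraph V) [DecidableRel G.Adj]
    (ξv : V → Bool → Prop) (ξe : V → V → Bool → Bool → Prop)
    (hξsym : ∀ u v s t, ξe u v s t ↔ ξe v u t s)
    (hac1 : ∀ u v, G.Adj u v → ∀ s t, ξe u v s t → ξv u s ∧ ξv v t)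
    (hac2 : ∀ u v, G.Adj u v → ∀ s, ξv u s → ∃ t, ξe u v s t)
    (hcover : ∀ u, ∃ s, ξv u s) :
    ∃ (μv : V → Bool → ℝ) (μe : V → V → Bool → Bool → ℝ),
      memLocal G (fun _ => Bool) μv μe ∧
      (∀ u s, μv u s = 0 ∨ μv u s = 1 / 2 ∨ μv u s = 1) ∧
      (∀ u v s t, μe u v s t = 0 ∨ μe u v s t = 1 / 2 ∨ μe u v s t = 1) ∧
      (∀ u s, 0 < μv u s → ξv u s) ∧
      (∀ u v, G.Adj u v → ∀ s t, 0 < μe u v s t → ξe u v s t) := by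
  have hflip : ∀ u v, (fun a b => ξe u v b a) = ξe v u := fun u v =>
    funext fun a => funext fun b => propext (hξsym u v b a)
  refine ⟨fun u => halfUnary (ξv u),
    fun u v s t => if G.Adj u v then halfCoupling (ξv u) (ξv v) (ξe u v) s t else 0,
    ⟨fun u => halfUnary_nonneg _, ?_, ?_, ?_, fun u => sum_halfUnary (hcover u), ?_, ?_⟩,
    fun u => halfUnary_mem _, ?_, fun u s => of_halfUnary_pos, ?_⟩
  · intro u v huv s t
    simpa only [if_pos huv] using halfCoupling_nonneg _ _ _ s t
  · intro u v s t
    simp only [G.adj_comm v u, halfCoupling_comm (ξv u), hflip]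
  · intro u v huv s t
    exact if_neg huv
  · intro u v huv t
    simpa only [if_pos huv] using sum_halfCoupling_left (hcover u) t
  · intro u v huv s
    simpa only [if_pos huv] using sum_halfCoupling_right (hcover v) s
  · intro u v s t
    dsimp only
    split_ifs
    · exact halfCoupling_mem _ _ _ s t
    · exact Or.inl rfl
  · intro u v huv s t h
    simp only [if_pos huv] at h
    refine of_halfCoupling_pos (hac1 u v huv) (hac2 u v huv) (fun b hb => ?_) h
    obtain ⟨a, ha⟩ := hac2 v u huv.symm b hb
    exact ⟨a, (hξsym v u b a).1 ha⟩
end
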